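/- arXiv:1801.05177 — 4 statements merged into one kernel-verified Lean document; each statement's English description precedes it below -/
import Mathlib

section
/- Let D be a strongly connected balanced bipartite digraph of order 2a ≥ 6 with partite sets X and Y. If d(x) + d(y) ≥ 3a for every pair of distinct vertices x, y either both in X or both in Y, then D contains cycles of every even length 2, 4, ..., 2a. -/
open Finset

section Defs

variable {V : Type*}

/-- `D` contains a directed cycle of length `k` (`k ≥ 2`): an injective map from
`ZMod k` such that consecutive vertices are joined by arcs. -/
def HasCycle (A : V → V → Prop) (k : ℕ) : Prop :=
  2 ≤ k ∧ ∃ f : ZMod k → V, Function.Injective f ∧ ∀ i, A (f i) (f (i + 1))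

/-- A digraph is strongly connected if every vertex is reachable from every other. -/
def StrongConn (A : V → V → Prop) : Prop := ∀ u v : V, Relation.ReflTransGen A u v

def outDeg [Fintype V] (A : V → V → Prop) [DecidableRel A] (u : V) : ℕ :=
  (Finset.univ.filter fun v => A u v).card

def inDeg [Fintype V] (A : V → V → Prop) [DecidableRel A] (u : V) : ℕ :=
  (Finset.univ.filter fun v => A v u).card

/-- total degree -/
def deg [Fintype V] (A : V → V → Prop) [DecidableRel A] (u : V) : ℕ :=
  outDeg A u + inDeg A u

/-- `D` is bipartite with partite sets `X`, `Y`: they partition the vertex set and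
every arc goes between the two sets. -/
def BipartiteWith [Fintype V] [DecidableEq V] (A : V → V → Prop) (X Y : Finset V) : Prop :=
  Disjoint X Y ∧ X ∪ Y = Finset.univ ∧
    ∀ u v, A u v → (u ∈ X ∧ v ∈ Y) ∨ (u ∈ Y ∧ v ∈ X)

/-- Bipartite digraph with explicitly indexed partite sets
`X = {x 0, …, x (a-1)}`, `Y = {y 0, …, y (a-1)}`. -/
def IndexedBipartite {a : ℕ} (A : V → V → Prop) (x y : Fin a → V) : Prop :=
  Function.Injective x ∧ Function.Injective y ∧ (∀ i j, x i ≠ y j) ∧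
  (∀ v : V, (∃ i, v = x i) ∨ (∃ i, v = y i)) ∧
  ∀ u v, A u v → (∃ i j, u = x i ∧ v = y j) ∨ (∃ i j, u = y i ∧ v = x j)

/-- The contracted digraph `D*[M]` of the matching `y i → x i`:
arc `v_l → v_j` (`l ≠ j`) iff `x l → y j` in `D`. -/
def Dstar {a : ℕ} (A : V → V → Prop) (x y : Fin a → V) : Fin a → Fin a → Prop :=
  fun l j => l ≠ j ∧ A (x l) (y j)

instance {a : ℕ} (A : V → V → Prop) [DecidableRel A] (x y : Fin a → V) :
    DecidableRel (Dstar A x y) := fun l j => by unfold Dstar; infer_instance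

/-- The size of a perfect matching `y i → x (π i)` from `Y` to `X`:
the number of matched pairs with no arc back from `X` to `Y`. -/
def matchSize {a : ℕ} (A : V → V → Prop) [DecidableRel A] (x y : Fin a → V)
    (π : Equiv.Perm (Fin a)) : ℕ :=
  (Finset.univ.filter fun i => ¬ A (x (π i)) (y i)).card

/-- `y i → x i` is a perfect matching from `Y` to `X` of maximum size among all
perfect matchings from `Y` to `X`. -/
def IsMaxMatching {a : ℕ} (A : V → V → Prop) [DecidableRel A] (x y : Fin a → V) : Prop :=
  (∀ i, A (y i) (x i)) ∧
  ∀ π : Equiv.Perm (Fin a), (∀ i, A (y i) (x (π i))) →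
    matchSize A x y π ≤ matchSize A x y 1

/-- `D` is a directed cycle: its arcs are exactly those of a cyclic ordering of all vertices. -/
def IsDirectedCycle [Fintype V] (A : V → V → Prop) : Prop :=
  ∃ e : V ≃ ZMod (Fintype.card V), ∀ u v, A u v ↔ e v = e u + 1

end Defs

/-- The two vertices lie on different sides of the bipartition `X`, `Xᶜ`. -/
abbrev Opp {V : Type*} (X : Finset V) (u v : V) : Prop := u ∈ X ↔ v ∉ X

/-- A cyclic permutation all of whose moves are arcs of `A`. -/
structure IsArcCycle {V : Type*} (A : V → V → Prop) (σ : Equiv.Perm V) : Prop where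
  isCycle : σ.IsCycle
  arc : ∀ v, σ v ≠ v → A v (σ v)

namespace IsArcCycle

variable {V : Type*} [Fintype V] [DecidableEq V] {A : V → V → Prop} {σ : Equiv.Perm V}

theorem hasCycle (h : IsArcCycle A σ) {k : ℕ} (hk : #σ.support = k) : HasCycle A k := by
  have h2 := h.isCycle.two_le_card_support
  have ho := h.isCycle.orderOf
  obtain ⟨c, hc, -⟩ := id h.isCycle
  rw [hk] at h2 ho
  have : NeZero k := ⟨by omega⟩
  have hper (n : ℕ) : (σ ^ (n % k)) c = (σ ^ n) c := by rw [← ho, pow_mod_orderOf]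
  have hval (i : ZMod k) : (σ ^ (i + 1).val) c = σ ((σ ^ i.val) c) := by
    rw [ZMod.val_add, hper, ← Equiv.Perm.mul_apply, ← pow_succ', ZMod.val_one'' (by omega)]
  refine ⟨h2, fun i => (σ ^ i.val) c, fun i j hij => ?_, fun i => ?_⟩
  · have := h.isCycle.pow_eq_pow_iff.2 ⟨c, hc, hij⟩
    rw [pow_inj_mod, ho, Nat.mod_eq_of_lt i.val_lt, Nat.mod_eq_of_lt j.val_lt] at this
    exact ZMod.val_injective k this
  · change A ((σ ^ i.val) c) ((σ ^ (i + 1).val) c)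
    rw [hval]
    refine h.arc _ fun h' => hc ?_
    rw [← Equiv.Perm.mul_apply, ← pow_succ', pow_succ, Equiv.Perm.mul_apply] at h'
    exact (σ ^ i.val).injective h'

theorem isCycle_mul_swap {σ : Equiv.Perm V} (h : σ.IsCycle) {c u : V} (hc : σ c ≠ c)
    (hu : σ u = u) :
    (σ * Equiv.swap c u).IsCycle ∧ (σ * Equiv.swap c u).support = insert u σ.support := by
  have huc : u ≠ c := by rintro rfl; exact hc hu
  have hσc : (σ * Equiv.swap c u) c = u := by simp [hu]
  have hσu : (σ * Equiv.swap c u) u = σ c := by simp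
  have hσ (v : V) (h1 : v ≠ c) (h2 : v ≠ u) : (σ * Equiv.swap c u) v = σ v := by
    simp [Equiv.swap_apply_of_ne_of_ne h1 h2]
  have hσcu : σ c ≠ u := by
    intro h'; exact huc (σ.injective (hu.trans h'.symm))
  have hsupp (v : V) : (σ * Equiv.swap c u) v ≠ v ↔ v = u ∨ σ v ≠ v := by
    by_cases h1 : v = c
    · subst h1; rw [hσc]; tauto
    · by_cases h2 : v = u
      · subst h2; rw [hσu]; tauto
      · rw [hσ v h1 h2]; tauto
  have hsame : (σ * Equiv.swap c u).SameCycle c u := ⟨1, by rw [zpow_one, hσc]⟩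
  have hstep (n : ℕ) : (σ * Equiv.swap c u).SameCycle c ((σ ^ n) c) := by
    induction n with
    | zero => exact Equiv.Perm.SameCycle.refl _ _
    | succ n ih =>
      rw [pow_succ', Equiv.Perm.mul_apply]
      by_cases h1 : (σ ^ n) c = c
      · rw [h1, ← hσu, Equiv.Perm.sameCycle_apply_right]
        exact hsame
      · have h2 : (σ ^ n) c ≠ u := by
          intro h2
          have : (σ ^ n) u = u := Equiv.Perm.pow_apply_eq_self_of_apply_eq_self hu n
          exact huc ((σ ^ n).injective (this.trans h2.symm))
        rw [← hσ _ h1 h2, Equiv.Perm.sameCycle_apply_right]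
        exact ih
  refine ⟨⟨c, by rw [hσc]; exact huc, fun v hv => ?_⟩, ?_⟩
  · rcases (hsupp v).1 hv with rfl | hv
    · exact hsame
    · obtain ⟨n, rfl⟩ := h.exists_pow_eq hc hv
      exact hstep n
  · ext v
    simp only [Equiv.Perm.mem_support, Finset.mem_insert]
    exact hsupp v

/-- Replacing the arc `c → σ c` by the path `c → u → w → σ c`. -/
theorem insert_arc (h : IsArcCycle A σ) {c u w : V} (hc : σ c ≠ c) (hu : σ u = u) (hw : σ w = w)
    (huw : u ≠ w) (hcu : A c u) (hAuw : A u w) (hwc : A w (σ c)) :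
    ∃ ρ, IsArcCycle A ρ ∧ ρ.support = insert u (insert w σ.support) := by
  obtain ⟨h1, h1s⟩ := isCycle_mul_swap h.isCycle hc hw
  have hwc' : w ≠ c := by rintro rfl; exact hc hw
  have huc' : u ≠ c := by rintro rfl; exact hc hu
  have e1 : (σ * Equiv.swap c w) c = w := by simp [hw]
  have e2 : (σ * Equiv.swap c w) u = u := by
    simp [Equiv.swap_apply_of_ne_of_ne huc' huw, hu]
  obtain ⟨h2, h2s⟩ := isCycle_mul_swap h1 (by rw [e1]; exact hwc') e2
  refine ⟨_, ⟨h2, fun v hv => ?_⟩, by rw [h2s, h1s]⟩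
  by_cases hvc : v = c
  · subst hvc; simpa [e2, Equiv.swap_apply_of_ne_of_ne huc' huw, hu] using hcu
  by_cases hvu : v = u
  · subst hvu; simpa [hw] using hAuw
  by_cases hvw : v = w
  · subst hvw
    simpa [Equiv.swap_apply_of_ne_of_ne hvc hvu] using hwc
  · have : (σ * Equiv.swap c w * Equiv.swap c u) v = σ v := by
      simp [Equiv.swap_apply_of_ne_of_ne hvc hvu, Equiv.swap_apply_of_ne_of_ne hvc hvw]
    rw [this] at hv ⊢
    exact h.arc v hv

omit [Fintype V] in
theorem swap {u v : V} (huv : u ≠ v) (h : A u v) (h' : A v u) :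
    IsArcCycle A (Equiv.swap u v) := by
  refine ⟨Equiv.Perm.isCycle_swap huv, fun x hx => ?_⟩
  by_cases h1 : x = u
  · subst h1; simpa using h
  by_cases h2 : x = v
  · subst h2; simpa using h'
  exact absurd (Equiv.swap_apply_of_ne_of_ne h1 h2) hx

end IsArcCycle

/-- The number of arcs between two vertices, in either direction. -/
def arcCount {V : Type*} (A : V → V → Prop) [DecidableRel A] (u v : V) : ℕ :=
  (if A u v then 1 else 0) + (if A v u then 1 else 0)

theorem arcCount_comm {V : Type*} (A : V → V → Prop) [DecidableRel A] (u v : V) :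
    arcCount A u v = arcCount A v u := add_comm _ _

theorem arcCount_eq_two {V : Type*} {A : V → V → Prop} [DecidableRel A] {u v : V} :
    arcCount A u v = 2 ↔ A u v ∧ A v u := by
  unfold arcCount
  split_ifs <;> simp_all

theorem deg_eq_sum_arcCount {V : Type*} [Fintype V] (A : V → V → Prop) [DecidableRel A] (v : V) :
    deg A v = ∑ u, arcCount A v u := by
  simp [deg, outDeg, inDeg, arcCount, Finset.sum_add_distrib]

/-- `T` has `m` vertices on each side of the bipartition `X`, `Xᶜ`. -/
def IsBalanced {V : Type*} [DecidableEq V] (X T : Finset V) (m : ℕ) : Prop :=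
  #{v ∈ T | v ∈ X} = m ∧ #{v ∈ T | v ∉ X} = m

namespace IsBalanced

variable {V : Type*} [DecidableEq V] {X T : Finset V} {m : ℕ}

theorem card_opp (h : IsBalanced X T m) (v : V) : #{u ∈ T | Opp X v u} = m := by
  by_cases hv : v ∈ X <;> simp [Opp, hv, h.1, h.2]

theorem card_not_opp (h : IsBalanced X T m) (v : V) : #{u ∈ T | ¬ Opp X v u} = m := by
  by_cases hv : v ∈ X <;> simp [Opp, hv, h.1, h.2]

theorem card_eq (h : IsBalanced X T m) : #T = 2 * m := by
  have := Finset.card_filter_add_card_filter_not (s := T) (fun v => v ∈ X)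
  rw [h.1, h.2] at this
  omega

theorem of_perm (g : Equiv.Perm V) (hg : ∀ v ∈ T, g v ∈ T) (hopp : ∀ v ∈ T, Opp X v (g v))
    (hT : #T = 2 * m) : IsBalanced X T m := by
  have h := Finset.card_filter_add_card_filter_not (s := T) (fun v => v ∈ X)
  have h1 : #{v ∈ T | v ∈ X} ≤ #{v ∈ T | v ∉ X} := by
    refine Finset.card_le_card_of_injOn g (fun v hv => ?_) g.injective.injOn
    simp only [Finset.coe_filter, Set.mem_ofPred_eq] at hv ⊢
    exact ⟨hg v hv.1, (hopp v hv.1).1 hv.2⟩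
  have h2 : #{v ∈ T | v ∉ X} ≤ #{v ∈ T | v ∈ X} := by
    refine Finset.card_le_card_of_injOn g (fun v hv => ?_) g.injective.injOn
    simp only [Finset.coe_filter, Set.mem_ofPred_eq] at hv ⊢
    exact ⟨hg v hv.1, by have := hopp v hv.1; tauto⟩
  constructor <;> omega

theorem sum_opp (h : IsBalanced X T m) (v : V) (k : ℕ) :
    ∑ u ∈ T, (if Opp X v u then k else 0) = m * k := by
  rw [← Finset.sum_filter, Finset.sum_const, h.card_opp, smul_eq_mul]

theorem sum_not_opp (h : IsBalanced X T m) (v : V) (k : ℕ) :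
    ∑ u ∈ T, (if ¬ Opp X v u then k else 0) = m * k := by
  rw [← Finset.sum_filter, Finset.sum_const, h.card_not_opp, smul_eq_mul]

theorem sum_sum_opp {S : Finset V} {n : ℕ} (hS : IsBalanced X S n) (h : IsBalanced X T m) (k : ℕ) :
    ∑ v ∈ S, ∑ u ∈ T, (if Opp X v u then k else 0) = 2 * n * (m * k) := by
  simp_rw [h.sum_opp, Finset.sum_const, hS.card_eq, smul_eq_mul]

end IsBalanced

/-- A strongly connected bipartite digraph with sides `X`, `Xᶜ` of size `a ≥ 3` in which the
degree sum of any two vertices on the same side is at least `3 * a`. -/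
structure IsDenseBipartite {V : Type*} [Fintype V] [DecidableEq V] (A : V → V → Prop)
    [DecidableRel A] (X : Finset V) (a : ℕ) : Prop where
  three_le : 3 ≤ a
  balanced : IsBalanced X Finset.univ a
  opp : ∀ u v, A u v → Opp X u v
  le_deg_add_deg : ∀ u v, u ≠ v → ¬ Opp X u v → 3 * a ≤ deg A u + deg A v
  strongConn : StrongConn A

/-- The cycle `σ` of length `2 * m` is a union of pairs of the matching `μ`, whose
edges carry arcs in both directions. -/
structure IsMatchedCycle {V : Type*} [Fintype V] [DecidableEq V] (A : V → V → Prop)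
    (μ σ : Equiv.Perm V) (m : ℕ) : Prop where
  isArcCycle : IsArcCycle A σ
  involutive : ∀ v, μ (μ v) = v
  arc : ∀ v, A v (μ v)
  closed : ∀ v, σ v ≠ v → σ (μ v) ≠ μ v
  card_support : #σ.support = 2 * m

section Dense

variable {V : Type*} [Fintype V] [DecidableEq V] {A : V → V → Prop} [DecidableRel A]
  {X : Finset V} {a : ℕ}

namespace IsDenseBipartite

theorem arcCount_le (hD : IsDenseBipartite A X a) (u v : V) :
    arcCount A u v ≤ if Opp X u v then 2 else 0 := by
  have h1 := hD.opp u v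
  have h2 := hD.opp v u
  unfold arcCount
  split_ifs <;> first | omega | tauto

theorem sum_arcCount_le (hD : IsDenseBipartite A X a) {S T : Finset V} {m n : ℕ}
    (hS : IsBalanced X S m) (hT : IsBalanced X T n) :
    ∑ u ∈ S, ∑ v ∈ T, arcCount A u v ≤ 4 * (m * n) := by
  calc _ ≤ ∑ u ∈ S, ∑ v ∈ T, (if Opp X u v then 2 else 0) :=
        Finset.sum_le_sum fun u _ => Finset.sum_le_sum fun v _ => hD.arcCount_le u v
    _ = 4 * (m * n) := by rw [hS.sum_sum_opp hT]; ring

theorem arc_of_le_sum_arcCount (hD : IsDenseBipartite A X a) {S T : Finset V} {m n : ℕ}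
    (hS : IsBalanced X S m) (hT : IsBalanced X T n)
    (h : 4 * (m * n) ≤ ∑ u ∈ S, ∑ v ∈ T, arcCount A u v) {u v : V} (hu : u ∈ S) (hv : v ∈ T)
    (huv : Opp X u v) : A u v := by
  have h1 : ∑ u ∈ S, ∑ v ∈ T, arcCount A u v = ∑ u ∈ S, ∑ v ∈ T, (if Opp X u v then 2 else 0) := by
    refine le_antisymm (Finset.sum_le_sum fun u _ => Finset.sum_le_sum fun v _ =>
      hD.arcCount_le u v) ?_
    rw [hS.sum_sum_opp hT]
    linarith
  have h2 := (Finset.sum_eq_sum_iff_of_le fun u _ => Finset.sum_le_sum fun v _ =>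
    hD.arcCount_le u v).1 h1 u hu
  have h3 := (Finset.sum_eq_sum_iff_of_le fun v _ => hD.arcCount_le u v).1 h2 v hv
  rw [if_pos huv] at h3
  exact (arcCount_eq_two.1 h3).1

theorem deg_eq_add (T : Finset V) (v : V) :
    deg A v = ∑ u ∈ T, arcCount A v u + ∑ u ∈ Tᶜ, arcCount A v u := by
  rw [deg_eq_sum_arcCount, Finset.sum_add_sum_compl]

/-- Summing the degree condition over all pairs across a balanced partition. -/
theorem le_sum_deg (hD : IsDenseBipartite A X a) {T : Finset V} {m r : ℕ}
    (hT : IsBalanced X T m) (hR : IsBalanced X Tᶜ r) :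
    6 * (a * (m * r)) ≤ r * ∑ v ∈ T, deg A v + m * ∑ v ∈ Tᶜ, deg A v := by
  have h1 : ∑ u ∈ T, ∑ v ∈ Tᶜ, (if ¬ Opp X u v then 3 * a else 0) = 6 * (a * (m * r)) := by
    simp_rw [hR.sum_not_opp, Finset.sum_const, hT.card_eq, smul_eq_mul]
    ring
  have h2 : ∑ u ∈ T, ∑ v ∈ Tᶜ, (if ¬ Opp X u v then deg A u else 0) = r * ∑ v ∈ T, deg A v := by
    simp_rw [hR.sum_not_opp, Finset.mul_sum]
  have h3 : ∑ u ∈ T, ∑ v ∈ Tᶜ, (if ¬ Opp X u v then deg A v else 0) =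
      m * ∑ v ∈ Tᶜ, deg A v := by
    rw [Finset.sum_comm, Finset.mul_sum]
    refine Finset.sum_congr rfl fun v _ => ?_
    rw [← hT.sum_not_opp v]
    refine Finset.sum_congr rfl fun u _ => if_congr (by unfold Opp; tauto) rfl rfl
  rw [← h1, ← h2, ← h3, ← Finset.sum_add_distrib]
  refine Finset.sum_le_sum fun u hu => ?_
  rw [← Finset.sum_add_distrib]
  refine Finset.sum_le_sum fun v hv => ?_
  have huv : u ≠ v := by rintro rfl; exact (Finset.mem_compl.1 hv) hu
  have := hD.le_deg_add_deg u v huv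
  split_ifs <;> first | omega | tauto

/-- If at most half of the possible arcs join the two parts of a balanced partition,
then both parts are complete. -/
theorem arc_of_sum_le (hD : IsDenseBipartite A X a) {T : Finset V} {m r : ℕ}
    (hT : IsBalanced X T m) (hR : IsBalanced X Tᶜ r) (hm : 0 < m) (hr : 0 < r)
    (h : ∑ u ∈ T, ∑ v ∈ Tᶜ, arcCount A u v ≤ 2 * (m * r)) {u v : V} (huv : Opp X u v)
    (hmem : u ∈ T ↔ v ∈ T) : A u v := by
  have hmr : m + r = a := by
    have h1 := hT.card_eq
    have h2 := hR.card_eq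
    have h3 := hD.balanced.card_eq
    have h4 := Finset.card_add_card_compl T
    rw [← Finset.card_univ] at h4
    omega
  have hcomm : ∑ u ∈ Tᶜ, ∑ v ∈ T, arcCount A u v = ∑ u ∈ T, ∑ v ∈ Tᶜ, arcCount A u v := by
    rw [Finset.sum_comm]
    simp_rw [arcCount_comm A]
  have h1 := hD.le_sum_deg hT hR
  simp_rw [deg_eq_add (A := A) T, Finset.sum_add_distrib] at h1
  rw [hcomm] at h1
  have h2 := hD.sum_arcCount_le hT hT
  have h3 := hD.sum_arcCount_le hR hR
  subst hmr
  by_cases hu : u ∈ T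
  · refine hD.arc_of_le_sum_arcCount hT hT ?_ hu (hmem.1 hu) huv
    refine le_of_mul_le_mul_left ?_ hr
    nlinarith
  · refine hD.arc_of_le_sum_arcCount hR hR ?_ (Finset.mem_compl.2 hu)
      (Finset.mem_compl.2 (hmem.not.1 hu)) huv
    refine le_of_mul_le_mul_left ?_ hm
    nlinarith

end IsDenseBipartite

namespace IsMatchedCycle

variable {μ σ : Equiv.Perm V} {m : ℕ}

omit [DecidableRel A] in
theorem mem_iff (h : IsMatchedCycle A μ σ m) (v : V) : μ v ∈ σ.support ↔ v ∈ σ.support := by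
  simp only [Equiv.Perm.mem_support]
  refine ⟨fun hv => ?_, h.closed v⟩
  simpa [h.involutive v] using h.closed _ hv

omit [DecidableRel A] in
theorem pos (h : IsMatchedCycle A μ σ m) : 0 < m := by
  have h1 := h.isArcCycle.isCycle.two_le_card_support
  have h2 := h.card_support
  omega

theorem balanced (h : IsMatchedCycle A μ σ m) (hD : IsDenseBipartite A X a) :
    IsBalanced X σ.support m :=
  .of_perm μ (fun v hv => (h.mem_iff v).2 hv) (fun v _ => hD.opp _ _ (h.arc v)) h.card_support

theorem balanced_compl (h : IsMatchedCycle A μ σ m) (hD : IsDenseBipartite A X a) :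
    IsBalanced X σ.supportᶜ (a - m) := by
  refine .of_perm μ (fun v hv => ?_) (fun v _ => hD.opp _ _ (h.arc v)) ?_
  · simpa only [Finset.mem_compl, h.mem_iff] using hv
  · rw [Finset.card_compl, ← Finset.card_univ, hD.balanced.card_eq, h.card_support]
    omega

omit [DecidableRel A] in
/-- A matched pair can be inserted at an arc of the cycle. -/
theorem exists_insert (h : IsMatchedCycle A μ σ m) {c v : V} (hc : c ∈ σ.support)
    (hv : v ∉ σ.support) (hne : v ≠ μ v) (hcv : A c v) (hvc : A (μ v) (σ c)) :
    ∃ ρ, IsMatchedCycle A μ ρ (m + 1) := by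
  have hv' : μ v ∉ σ.support := (h.mem_iff v).not.2 hv
  obtain ⟨ρ, hρ, hs⟩ := h.isArcCycle.insert_arc (Equiv.Perm.mem_support.1 hc)
    (Equiv.Perm.notMem_support.1 hv) (Equiv.Perm.notMem_support.1 hv') hne hcv (h.arc v) hvc
  refine ⟨ρ, hρ, h.involutive, h.arc, fun x hx => ?_, ?_⟩
  · rw [← Equiv.Perm.mem_support, hs] at hx ⊢
    simp only [Finset.mem_insert, h.mem_iff, EmbeddingLike.apply_eq_iff_eq] at hx ⊢
    rcases hx with rfl | rfl | hx
    · tauto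
    · exact Or.inl (h.involutive v)
    · tauto
  · rw [hs, Finset.card_insert_of_notMem, Finset.card_insert_of_notMem hv', h.card_support]
    · ring
    · simp [hne, Equiv.Perm.notMem_support.1 hv]

/-- If no matched pair can be inserted, at most half of the possible arcs leave the cycle. -/
theorem sum_arcCount_le (h : IsMatchedCycle A μ σ m) (hD : IsDenseBipartite A X a)
    (hno : ∀ c ∈ σ.support, ∀ v ∉ σ.support, A c v → ¬ A (μ v) (σ c)) :
    ∑ u ∈ σ.support, ∑ v ∈ σ.supportᶜ, arcCount A u v ≤ 2 * (m * (a - m)) := by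
  have h1 : ∑ u ∈ σ.support, ∑ v ∈ σ.supportᶜ, (if A (μ v) (σ u) then 1 else 0) =
      ∑ u ∈ σ.support, ∑ v ∈ σ.supportᶜ, (if A v u then 1 else 0) :=
    Finset.sum_equiv σ (fun u => by simp) fun u _ =>
      Finset.sum_equiv μ (fun v => by rw [Finset.mem_compl, Finset.mem_compl, h.mem_iff])
        fun v _ => rfl
  simp_rw [arcCount, Finset.sum_add_distrib]
  rw [← h1]
  simp_rw [← Finset.sum_add_distrib]
  have h2 := (h.balanced hD).sum_sum_opp (h.balanced_compl hD) 1
  rw [mul_one, mul_assoc] at h2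
  rw [← h2]
  refine Finset.sum_le_sum fun u hu => Finset.sum_le_sum fun v hv => ?_
  have e1 := hno u hu v (Finset.mem_compl.1 hv)
  have e2 := hD.opp u v
  have e3 := hD.opp (μ v) (σ u)
  have e4 := hD.opp _ _ (h.arc v)
  have e5 := hD.opp _ _ (h.isArcCycle.arc u (Equiv.Perm.mem_support.1 hu))
  split_ifs <;> first | omega | tauto

omit [DecidableRel A] in
/-- Two vertices of the cycle on the same side may trade places if the vertices of the cycle
induce a complete bipartite digraph. -/
theorem conj_cycle (h : IsMatchedCycle A μ σ m)
    (hopp : ∀ u v, A u v → Opp X u v)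
    (hcomplete : ∀ u ∈ σ.support, ∀ v ∈ σ.support, Opp X u v → A u v)
    {c d : V} (hc : c ∈ σ.support) (hd : d ∈ σ.support) (hcd : ¬ Opp X c d) :
    IsMatchedCycle A μ (Equiv.swap c d * σ * (Equiv.swap c d)⁻¹) m ∧
      (Equiv.swap c d * σ * (Equiv.swap c d)⁻¹).support = σ.support := by
  have hmem (v : V) : Equiv.swap c d v ∈ σ.support ↔ v ∈ σ.support := by
    rw [Equiv.swap_apply_def]; split_ifs <;> simp_all
  have hside (v : V) : Equiv.swap c d v ∈ X ↔ v ∈ X := by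
    rw [Equiv.swap_apply_def]; unfold Opp at hcd; split_ifs <;> subst_vars <;> tauto
  have hs : (Equiv.swap c d * σ * (Equiv.swap c d)⁻¹).support = σ.support := by
    ext v
    rw [← hmem v, Equiv.Perm.mem_support, Equiv.Perm.mem_support, Equiv.Perm.mul_apply,
      Equiv.Perm.mul_apply, Equiv.swap_inv, ne_eq, ne_eq, Equiv.swap_apply_eq_iff]
  refine ⟨⟨⟨h.isArcCycle.isCycle.conj, fun v hv => ?_⟩, h.involutive, h.arc, fun v => ?_, ?_⟩, hs⟩
  · rw [← Equiv.Perm.mem_support, hs] at hv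
    refine hcomplete v hv _ ?_ ?_
    · rw [Equiv.Perm.mul_apply, Equiv.Perm.mul_apply, hmem, Equiv.Perm.apply_mem_support,
        Equiv.swap_inv, hmem]
      exact hv
    · have h1 := hopp _ _ (h.isArcCycle.arc _ (Equiv.Perm.mem_support.1 ((hmem v).2 hv)))
      have h2 := hside v
      have h3 := hside (σ (Equiv.swap c d v))
      rw [Equiv.Perm.mul_apply, Equiv.Perm.mul_apply, Equiv.swap_inv]
      tauto
  · rw [← Equiv.Perm.mem_support, ← Equiv.Perm.mem_support, hs, h.mem_iff]
    exact id
  · rw [hs, h.card_support]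

omit [DecidableRel A] in
/-- Two vertices off the cycle on the same side may trade partners if the vertices off the cycle
induce a complete bipartite digraph. -/
theorem conj_matching (h : IsMatchedCycle A μ σ m)
    (hopp : ∀ u v, A u v → Opp X u v)
    (hcomplete : ∀ u ∉ σ.support, ∀ v ∉ σ.support, Opp X u v → A u v)
    {c d : V} (hc : c ∉ σ.support) (hd : d ∉ σ.support) (hcd : ¬ Opp X c d) :
    IsMatchedCycle A (Equiv.swap c d * μ * (Equiv.swap c d)⁻¹) σ m := by
  have hmem (v : V) : Equiv.swap c d v ∈ σ.support ↔ v ∈ σ.support := by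
    rw [Equiv.swap_apply_def]; split_ifs <;> simp_all
  have hside (v : V) : Equiv.swap c d v ∈ X ↔ v ∈ X := by
    rw [Equiv.swap_apply_def]; unfold Opp at hcd; split_ifs <;> subst_vars <;> tauto
  have hfix (v : V) (hv : v ∈ σ.support) : Equiv.swap c d v = v :=
    Equiv.swap_apply_of_ne_of_ne (by rintro rfl; exact hc hv) (by rintro rfl; exact hd hv)
  refine ⟨h.isArcCycle, fun v => ?_, fun v => ?_, fun v => ?_, h.card_support⟩
  · simp [h.involutive]
  · simp only [Equiv.Perm.mul_apply, Equiv.swap_inv]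
    by_cases hv : v ∈ σ.support
    · rw [hfix v hv, hfix _ ((h.mem_iff v).2 hv)]
      exact h.arc v
    · refine hcomplete v hv _ ?_ ?_
      · rwa [hmem, h.mem_iff, hmem]
      · have h1 := hopp _ _ (h.arc (Equiv.swap c d v))
        have h2 := hside v
        have h3 := hside (μ (Equiv.swap c d v))
        tauto
  · rw [← Equiv.Perm.mem_support, ← Equiv.Perm.mem_support, Equiv.Perm.mul_apply,
      Equiv.Perm.mul_apply, hmem, h.mem_iff, Equiv.swap_inv, hmem]
    exact id

end IsMatchedCycle

theorem StrongConn.exists_arc {V : Type*} {A : V → V → Prop} (h : StrongConn A) {p : V → Prop}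
    {u v : V} (hu : p u) (hv : ¬ p v) : ∃ x y, p x ∧ ¬ p y ∧ A x y := by
  by_contra! hno
  have : ∀ w, Relation.ReflTransGen A u w → p w := by
    intro w hw
    induction hw with
    | refl => exact hu
    | tail _ hxy ih =>
      by_contra hy
      exact hno _ _ ih hy hxy
  exact hv (this v (h u v))

theorem IsDenseBipartite.deg_le (hD : IsDenseBipartite A X a) {T : Finset V} {m : ℕ}
    (hT : IsBalanced X T m) {v : V} (h : ∀ u ∉ T, ¬ A u v ∧ ¬ A v u) : deg A v ≤ 2 * m := by
  rw [IsDenseBipartite.deg_eq_add T, Finset.sum_eq_zero (s := Tᶜ), add_zero, mul_comm, ← hT.sum_opp v]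
  · exact Finset.sum_le_sum fun u _ => hD.arcCount_le v u
  · intro u hu
    have := h u (Finset.mem_compl.1 hu)
    simp [arcCount, this]

namespace IsMatchedCycle

variable {μ σ : Equiv.Perm V} {m : ℕ}

/-- An arc leaving the cycle and an arc entering it allow a longer matched cycle, if they fit
together and both parts are complete. -/
theorem exists_of_arcs (h : IsMatchedCycle A μ σ m) (hD : IsDenseBipartite A X a)
    (hcomplete : ∀ u v, Opp X u v → (u ∈ σ.support ↔ v ∈ σ.support) → A u v)
    {c c' u w : V} (hc : c ∈ σ.support) (hc' : c' ∈ σ.support) (hu : u ∉ σ.support)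
    (hw : w ∉ σ.support) (huw : Opp X u w) (hcu : A c u) (hwc : A w c') :
    ∃ ν ρ, IsMatchedCycle A ν ρ (m + 1) := by
  have o1 := hD.opp _ _ hcu
  have o2 := hD.opp _ _ hwc
  have o3 := hD.opp _ _ (h.arc u)
  obtain ⟨d, hσd⟩ := σ.surjective c'
  have hdT : d ∈ σ.support := by rwa [← Equiv.Perm.apply_mem_support, hσd]
  have o4 := hD.opp _ _ (h.isArcCycle.arc d (Equiv.Perm.mem_support.1 hdT))
  rw [hσd] at o4
  obtain ⟨h1, h1s⟩ := h.conj_cycle hD.opp (fun u hu v hv huv => hcomplete u v huv (by grind))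
    hc hdT (by grind)
  have h2 := h1.conj_matching (c := w) (d := μ u) hD.opp
    (fun u hu v hv huv => hcomplete u v huv (by rw [h1s] at hu hv; grind))
    (by rwa [h1s]) (by rwa [h1s, h.mem_iff]) (by grind)
  have e1 : (Equiv.swap w (μ u) * μ * (Equiv.swap w (μ u))⁻¹) u = w := by
    have : Equiv.swap w (μ u) u = u :=
      Equiv.swap_apply_of_ne_of_ne (by rintro rfl; grind) (by intro h'; rw [← h'] at o3; grind)
    simp [this]
  have e2 : (Equiv.swap c d * σ * (Equiv.swap c d)⁻¹) c = c' := by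
    have : Equiv.swap c d c' = c' :=
      Equiv.swap_apply_of_ne_of_ne (by rintro rfl; grind) (by rintro h'; rw [← h'] at o4; grind)
    simp [hσd, this]
  refine ⟨_, h2.exists_insert (c := c) (v := u) (by rwa [h1s]) (by rwa [h1s]) ?_ hcu ?_⟩
  · rw [e1]; rintro rfl; grind
  · rwa [e1, e2]

theorem exists_succ (h : IsMatchedCycle A μ σ m) (hD : IsDenseBipartite A X a) (hm : m < a) :
    ∃ ν ρ, IsMatchedCycle A ν ρ (m + 1) := by
  by_contra hno
  have hT := h.balanced hD
  have hR := h.balanced_compl hD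
  have hne (v : V) : v ≠ μ v := by
    intro h'
    have := hD.opp _ _ (h.arc v)
    rw [← h'] at this
    grind
  have hcomplete (u v : V) (huv : Opp X u v) : (u ∈ σ.support ↔ v ∈ σ.support) → A u v :=
    hD.arc_of_sum_le hT hR h.pos (by omega) (h.sum_arcCount_le hD fun c hc v hv h1 h2 =>
      hno ⟨μ, h.exists_insert hc hv (hne v) h1 h2⟩) huv
  have hcross {c c' u w : V} (hc : c ∈ σ.support) (hc' : c' ∈ σ.support) (hu : u ∉ σ.support)
      (hw : w ∉ σ.support) (hcu : A c u) (hwc : A w c') : ¬ Opp X u w := fun huw =>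
    hno (h.exists_of_arcs hD hcomplete hc hc' hu hw huw hcu hwc)
  have ha := hD.three_le
  have hpos := h.pos
  obtain ⟨p, hp⟩ : σ.support.Nonempty := by
    rw [← Finset.card_pos, h.card_support]; omega
  obtain ⟨q, hq⟩ : σ.supportᶜ.Nonempty := by
    rw [← Finset.card_pos, hR.card_eq]; omega
  rw [Finset.mem_compl] at hq
  obtain ⟨c, u, hc, hu, hcu⟩ := hD.strongConn.exists_arc (p := (· ∈ σ.support)) hp hq
  obtain ⟨w, c', hw, hc', hwc⟩ :=
    hD.strongConn.exists_arc (p := (· ∉ σ.support)) hq (not_not.2 hp)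
  rw [not_not] at hc'
  have o0 := hD.opp _ _ hcu
  have o1 := hcross hc hc' hu hw hcu hwc
  have hout {x y : V} (hx : x ∈ σ.support) (hy : y ∉ σ.support) (hxy : A x y ∨ A y x) :
      ¬ Opp X u y := by
    rcases hxy with hxy | hyx
    · have := hcross hx hc' hy hw hxy hwc
      grind
    · exact hcross hc hx hu hy hcu hyx
  have hdegT {x : V} (hx : x ∈ σ.support) (hux : ¬ Opp X u x) : deg A x ≤ 2 * m := by
    refine hD.deg_le hT fun y hy => ?_
    have h1 := hout hx hy
    have h2 := hD.opp x y
    have h3 := hD.opp y x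
    grind
  have hdegR {y : V} (hy : y ∉ σ.support) (huy : Opp X u y) : deg A y ≤ 2 * (a - m) := by
    refine hD.deg_le hR fun x hx => ?_
    have := hout (by simpa only [Finset.mem_compl, not_not] using hx) hy
    grind
  have hdeg (v : V) : deg A v ≤ 2 * a := hD.deg_le hD.balanced (by simp)
  have o2 := hD.opp _ _ (h.arc c)
  have o3 := hD.opp _ _ (h.arc u)
  have hcT := (h.mem_iff c).2 hc
  have huT := (h.mem_iff u).not.2 hu
  have d1 := hD.le_deg_add_deg (μ c) u (by rintro rfl; grind) (by grind)
  have d2 := hD.le_deg_add_deg (μ u) c (by rintro rfl; grind) (by grind)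
  have d3 := hdeg u
  have d4 := hdeg c
  have d5 := hdegT hcT (by grind)
  have d6 := hdegR huT (by grind)
  obtain ⟨x, hx, hxc⟩ := Finset.exists_mem_ne
    (by rw [hT.card_not_opp u]; omega : 1 < #{v ∈ σ.support | ¬ Opp X u v}) (μ c)
  rw [Finset.mem_filter] at hx
  have d7 := hD.le_deg_add_deg x (μ c) hxc (by grind)
  have d8 := hdegT hx.1 hx.2
  omega

end IsMatchedCycle

namespace IsDenseBipartite

theorem card_filter_opp (hD : IsDenseBipartite A X a) (v : V) : #{u | Opp X v u} = a :=
  hD.balanced.card_opp v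

theorem nbr_subset (hD : IsDenseBipartite A X a) (v : V) :
    ({u | A v u ∧ A u v} : Finset V) ⊆ ({u | Opp X v u} : Finset V) := fun u hu => by
  have := hD.opp v u
  simp only [Finset.mem_filter, Finset.mem_univ, true_and] at hu ⊢
  exact this hu.1

theorem deg_le_add_card (hD : IsDenseBipartite A X a) (v : V) :
    deg A v ≤ a + #{u | A v u ∧ A u v} := by
  rw [Finset.filter_and, deg, outDeg, inDeg, ← Finset.card_union_add_card_inter,
    ← hD.card_filter_opp v]
  gcongr
  intro u hu
  have h1 := hD.opp v u
  have h2 := hD.opp u v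
  simp only [Finset.mem_union, Finset.mem_filter, Finset.mem_univ, true_and] at hu ⊢
  tauto

theorem le_card_add_card (hD : IsDenseBipartite A X a) {u v : V} (huv : u ≠ v)
    (h : ¬ Opp X u v) : a ≤ #{x | A u x ∧ A x u} + #{x | A v x ∧ A x v} := by
  have h1 := hD.le_deg_add_deg u v huv h
  have h2 := hD.deg_le_add_card u
  have h3 := hD.deg_le_add_card v
  omega

/-- If no arc at `v` has a reverse arc, the other vertices on the side of `v` are joined to
everything, and cycles of all even lengths exist. -/
theorem exists_isArcCycle_of_forall_not (hD : IsDenseBipartite A X a) {v : V}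
    (hv : ∀ u, ¬ (A v u ∧ A u v)) {k : ℕ} (hk : 1 ≤ k) (hka : k ≤ a) :
    ∃ σ, IsArcCycle A σ ∧ #σ.support = 2 * k := by
  have ha := hD.three_le
  have hfull {w u : V} (hwv : w ≠ v) (hw : ¬ Opp X v w) (hwu : Opp X w u) : A w u ∧ A u w := by
    have h1 := hD.le_card_add_card hwv.symm hw
    rw [Finset.card_eq_zero.2 (by simpa [Finset.filter_eq_empty_iff] using hv), zero_add] at h1
    have h2 := Finset.eq_of_subset_of_card_le (hD.nbr_subset w) (by rwa [hD.card_filter_opp])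
    have h3 : u ∈ ({u | Opp X w u} : Finset V) := by simpa using hwu
    rw [← h2] at h3
    exact (Finset.mem_filter.1 h3).2
  obtain ⟨z, hz, hzv⟩ := Finset.exists_mem_ne
    (by rw [hD.balanced.card_not_opp v]; omega : 1 < #{u | ¬ Opp X v u}) v
  replace hz : ¬ Opp X v z := by simpa using hz
  obtain ⟨p, _, hp, h', hpv⟩ := hD.strongConn.exists_arc (p := (· ≠ v)) hzv (not_not.2 rfl)
  rw [not_not] at h'
  rw [h'] at hpv
  obtain ⟨_, q, h', hq, hvq⟩ := hD.strongConn.exists_arc (p := (· = v)) rfl hzv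
  rw [h'] at hvq
  have hpq : p ≠ q := by rintro rfl; exact hv p ⟨hvq, hpv⟩
  have o1 := hD.opp _ _ hpv
  have o2 := hD.opp _ _ hvq
  obtain ⟨hzp, hpz⟩ := hfull hzv hz (u := p) (by tauto)
  obtain ⟨hzq, hqz⟩ := hfull hzv hz (u := q) (by tauto)
  have hzp' : z ≠ p := by rintro rfl; tauto
  have hzq' : z ≠ q := by rintro rfl; tauto
  have h2 := IsArcCycle.swap hzp' hzp hpz
  have h2s := Equiv.Perm.support_swap hzp'
  rcases hk.eq_or_lt with rfl | hk
  · exact ⟨_, h2, by rw [h2s, Finset.card_pair hzp']⟩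
  suffices ∃ σ, IsArcCycle A σ ∧ v ∈ σ.support ∧ z ∈ σ.support ∧ #σ.support = 2 * k by
    obtain ⟨σ, h1, -, -, h2⟩ := this
    exact ⟨σ, h1, h2⟩
  induction k, hk using Nat.le_induction with
  | base =>
    obtain ⟨ρ, hρ, hs⟩ := h2.insert_arc (c := p) (u := v) (w := q) (by simpa using hzp')
      (Equiv.swap_apply_of_ne_of_ne hzv.symm hp.symm)
      (Equiv.swap_apply_of_ne_of_ne hzq'.symm hpq.symm) (Ne.symm hq) hpv hvq (by simpa using hqz)
    rw [h2s] at hs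
    refine ⟨ρ, hρ, by simp [hs], by simp [hs], ?_⟩
    rw [hs, Finset.card_insert_of_notMem, Finset.card_insert_of_notMem, Finset.card_pair hzp']
    · simp [hzq'.symm, hpq.symm]
    · simp [(Ne.symm hq), hzv.symm, hp.symm]
  | succ k hk ih =>
    obtain ⟨σ, hσ, hvσ, hzσ, hcard⟩ := ih (by omega) (by omega)
    have hT : IsBalanced X σ.support k := .of_perm σ (by simp)
      (fun x hx => hD.opp _ _ (hσ.arc x (Equiv.Perm.mem_support.1 hx))) hcard
    obtain ⟨u, hu, hu'⟩ := Finset.exists_mem_notMem_of_card_lt_card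
      (by rw [hT.card_opp v, hD.card_filter_opp v]; omega :
        #{u ∈ σ.support | Opp X v u} < #{u | Opp X v u})
    obtain ⟨w, hw, hw'⟩ := Finset.exists_mem_notMem_of_card_lt_card
      (by rw [hT.card_not_opp v, hD.balanced.card_not_opp v]; omega :
        #{u ∈ σ.support | ¬ Opp X v u} < #{u | ¬ Opp X v u})
    simp only [Finset.mem_filter, Finset.mem_univ, true_and] at hu hu' hw hw'
    replace hu' : u ∉ σ.support := fun h => hu' ⟨h, hu⟩
    replace hw' : w ∉ σ.support := fun h => hw' ⟨h, hw⟩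
    have hwv : w ≠ v := by rintro rfl; exact hw' hvσ
    have huw : u ≠ w := by rintro rfl; exact hw hu
    have o3 := hD.opp _ _ (hσ.arc z (Equiv.Perm.mem_support.1 hzσ))
    obtain ⟨ρ, hρ, hs⟩ := hσ.insert_arc (Equiv.Perm.mem_support.1 hzσ)
      (Equiv.Perm.notMem_support.1 hu') (Equiv.Perm.notMem_support.1 hw') huw
      (hfull hzv hz (by grind)).1 (hfull hwv hw (by grind)).2
      (hfull hwv hw (by grind)).1
    refine ⟨ρ, hρ, ?_, ?_, ?_⟩
    · simp only [hs, Finset.mem_insert, hvσ, or_true]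
    · simp only [hs, Finset.mem_insert, hzσ, or_true]
    · rw [hs, Finset.card_insert_of_notMem, Finset.card_insert_of_notMem hw', hcard]
      · ring
      · simp only [Finset.mem_insert, huw, hu', or_self, not_false_eq_true]

/-- If every vertex lies on a 2-cycle, there is a perfect matching by 2-cycles. -/
theorem exists_matching (hD : IsDenseBipartite A X a) (h : ∀ v, ∃ u, A v u ∧ A u v) :
    ∃ μ : Equiv.Perm V, (∀ v, μ (μ v) = v) ∧ ∀ v, A v (μ v) := by
  have ha := hD.three_le
  have hhall (S : Finset {x // x ∈ X}) :
      #S ≤ #(S.biUnion fun x => ({u | A x u ∧ A u x} : Finset V)) := by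
    by_contra! hlt
    set N := S.biUnion fun x => ({u | A x u ∧ A u x} : Finset V) with hN
    have hsub (x) (hx : x ∈ S) : #{u | A (x : V) u ∧ A u x} ≤ #N :=
      Finset.card_le_card (Finset.subset_biUnion_of_mem
        (fun x : {x // x ∈ X} => ({u | A x u ∧ A u x} : Finset V)) hx)
    have hpos (v : V) : 0 < #{u | A v u ∧ A u v} := by
      obtain ⟨u, hu⟩ := h v
      exact Finset.card_pos.2 ⟨u, by simpa using hu⟩
    obtain ⟨x, hx⟩ : S.Nonempty := Finset.card_pos.1 (by omega)
    have h1 := (hpos x).trans_le (hsub x hx)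
    obtain ⟨x', hx', hne⟩ := Finset.exists_mem_ne (by omega : 1 < #S) x
    have h2 := hD.le_card_add_card (u := x) (v := x') (fun h => hne (Subtype.ext h.symm))
      (by have := x.2; have := x'.2; tauto)
    have h3 := hsub x hx
    have h4 := hsub x' hx'
    have hSle (y : V) (hy : y ∉ X) (hyN : y ∉ N) : #{u | A y u ∧ A u y} + #S ≤ a := by
      rw [← hD.balanced.1, ← Finset.card_map (Function.Embedding.subtype _),
        ← Finset.card_union_of_disjoint]
      · refine Finset.card_le_card fun u hu => ?_
        simp only [Finset.mem_union, Finset.mem_filter, Finset.mem_univ, true_and,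
          Finset.mem_map, Function.Embedding.subtype_apply] at hu ⊢
        rcases hu with hu | ⟨u, -, rfl⟩
        · have := hD.opp _ _ hu.1
          tauto
        · exact u.2
      · refine Finset.disjoint_left.2 fun u hu hu' => hyN ?_
        simp only [Finset.mem_filter, Finset.mem_univ, true_and, Finset.mem_map,
          Function.Embedding.subtype_apply] at hu hu'
        obtain ⟨u, huS, rfl⟩ := hu'
        exact Finset.mem_biUnion.2 ⟨u, huS, by simpa using hu.symm⟩
    have hcompl : #N + #{y | y ∉ X ∧ y ∉ N} = a := by
      rw [← hD.balanced.2, ← Finset.card_filter_add_card_filter_not (s := {y | y ∉ X}) (fun y => y ∈ N),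
        Finset.filter_filter, Finset.filter_filter]
      congr 2
      ext y
      simp only [Finset.mem_filter, Finset.mem_univ, true_and, iff_and_self, hN,
        Finset.mem_biUnion, forall_exists_index, and_imp]
      intro x _ hxy _
      have := hD.opp _ _ hxy
      have := x.2
      tauto
    have hSa : #S ≤ a := by
      rw [← hD.balanced.1, ← Finset.card_map (Function.Embedding.subtype _)]
      refine Finset.card_le_card fun u hu => ?_
      simp only [Finset.mem_filter, Finset.mem_univ, true_and,
          Finset.mem_map, Function.Embedding.subtype_apply] at hu ⊢
      obtain ⟨u, -, rfl⟩ := hu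
      exact u.2
    obtain ⟨y, hy⟩ : ({y | y ∉ X ∧ y ∉ N} : Finset V).Nonempty := Finset.card_pos.1 (by omega)
    have hy1 := (Finset.mem_filter.1 hy).2
    have h5 := hSle y hy1.1 hy1.2
    have h6 := hpos y
    obtain ⟨y', hy', hne'⟩ := Finset.exists_mem_ne
      (by omega : 1 < #({y | y ∉ X ∧ y ∉ N} : Finset V)) y
    have hy2 := (Finset.mem_filter.1 hy').2
    have h7 := hSle y' hy2.1 hy2.2
    have h8 := hD.le_card_add_card hne' (by tauto)
    omega
  obtain ⟨f, hf, hfA⟩ := (Finset.all_card_le_biUnion_card_iff_exists_injective _).1 hhall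
  simp only [Finset.mem_filter, Finset.mem_univ, true_and] at hfA
  have hfX (x : {x // x ∈ X}) : f x ∉ X := by
    have := hD.opp _ _ (hfA x).1
    have := x.2
    tauto
  let g : {x // x ∈ X} → {x // x ∉ X} := fun x => ⟨f x, hfX x⟩
  have hg : Function.Bijective g := by
    refine (Fintype.bijective_iff_injective_and_card g).2
      ⟨fun x y hxy => hf (congrArg Subtype.val hxy), ?_⟩
    rw [Fintype.card_subtype, Fintype.card_subtype, hD.balanced.1, hD.balanced.2]
  let e := Equiv.ofBijective g hg
  have he (y : {x // x ∉ X}) : f (e.symm y) = y := congrArg Subtype.val (e.apply_symm_apply y)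
  let μ : V → V := fun v => if hv : v ∈ X then f ⟨v, hv⟩ else e.symm ⟨v, hv⟩
  have hμ : Function.Involutive μ := fun v => by
    by_cases hv : v ∈ X
    · have h1 : μ v = f ⟨v, hv⟩ := dif_pos hv
      have h2 : μ (f ⟨v, hv⟩) = e.symm ⟨f ⟨v, hv⟩, hfX _⟩ := dif_neg (hfX _)
      rw [h1, h2]
      exact congrArg Subtype.val (e.symm_apply_apply ⟨v, hv⟩)
    · have h1 : μ v = e.symm ⟨v, hv⟩ := dif_neg hv
      have h2 : μ (e.symm ⟨v, hv⟩) = f (e.symm ⟨v, hv⟩) := dif_pos (e.symm ⟨v, hv⟩).2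
      rw [h1, h2, he]
  refine ⟨hμ.toPerm, hμ, fun v => ?_⟩
  change A v (μ v)
  by_cases hv : v ∈ X
  · have h1 : μ v = f ⟨v, hv⟩ := dif_pos hv
    rw [h1]
    exact (hfA ⟨v, hv⟩).1
  · have h1 : μ v = e.symm ⟨v, hv⟩ := dif_neg hv
    have h2 := (hfA (e.symm ⟨v, hv⟩)).2
    rw [he] at h2
    rwa [h1]

theorem exists_isArcCycle (hD : IsDenseBipartite A X a) {k : ℕ} (hk : 1 ≤ k) (hka : k ≤ a) :
    ∃ σ, IsArcCycle A σ ∧ #σ.support = 2 * k := by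
  by_cases h : ∃ v, ∀ u, ¬ (A v u ∧ A u v)
  · obtain ⟨v, hv⟩ := h
    exact hD.exists_isArcCycle_of_forall_not hv hk hka
  push Not at h
  obtain ⟨μ, hμ, hA⟩ := hD.exists_matching h
  suffices ∃ ν σ, IsMatchedCycle A ν σ k by
    obtain ⟨ν, σ, hσ⟩ := this
    exact ⟨σ, hσ.isArcCycle, hσ.card_support⟩
  induction k, hk using Nat.le_induction with
  | base =>
    obtain ⟨v⟩ : Nonempty V := by
      rw [← Fintype.card_pos_iff, ← Finset.card_univ, hD.balanced.card_eq]
      have := hD.three_le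
      omega
    have hne : v ≠ μ v := by
      intro h'
      have := hD.opp _ _ (hA v)
      rw [← h'] at this
      tauto
    have hs := Equiv.Perm.support_swap hne
    refine ⟨μ, Equiv.swap v (μ v), .swap hne (hA v) (by simpa [hμ] using hA (μ v)), hμ, hA,
      fun u hu => ?_, by rw [hs, Finset.card_pair hne]⟩
    rw [← Equiv.Perm.mem_support, hs, Finset.mem_insert, Finset.mem_singleton] at hu ⊢
    rcases hu with rfl | rfl
    · exact Or.inr rfl
    · exact Or.inl (hμ v)
  | succ k hk ih =>
    obtain ⟨ν, σ, hσ⟩ := ih (by omega)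
    exact hσ.exists_succ hD hka

end IsDenseBipartite

end Dense

/-- main theorem (even pancyclicity). -/
theorem stmt0 {V : Type*} [Fintype V] [DecidableEq V] (A : V → V → Prop) [DecidableRel A]
    (a : ℕ) (ha : 3 ≤ a) (X Y : Finset V)
    (hcard : Fintype.card V = 2 * a) (hX : X.card = a) (hY : Y.card = a)
    (hbip : BipartiteWith A X Y) (hstrong : StrongConn A)
    (hdeg : ∀ u v : V, u ≠ v → ((u ∈ X ∧ v ∈ X) ∨ (u ∈ Y ∧ v ∈ Y)) →
      3 * a ≤ deg A u + deg A v) :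
    ∀ k : ℕ, 1 ≤ k → k ≤ a → HasCycle A (2 * k) := by
  intro k hk hka
  have hXY (v : V) : v ∉ X ↔ v ∈ Y := by
    have h1 : v ∈ X ∪ Y := hbip.2.1 ▸ Finset.mem_univ v
    have h2 : v ∈ X → v ∉ Y := fun h => Finset.disjoint_left.1 hbip.1 h
    rw [Finset.mem_union] at h1
    tauto
  have hD : IsDenseBipartite A X a :=
    { three_le := ha
      balanced := by
        refine ⟨?_, ?_⟩
        · rw [Finset.filter_univ_mem, hX]
        · simp_rw [hXY]
          rw [Finset.filter_univ_mem, hY]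
      opp := fun u v huv => by
        have h1 := hbip.2.2 u v huv
        rw [← hXY, ← hXY] at h1
        tauto
      le_deg_add_deg := fun u v huv h => by
        refine hdeg u v huv ?_
        rw [← hXY, ← hXY]
        tauto
      strongConn := hstrong }
  obtain ⟨σ, hσ, hcard⟩ := hD.exists_isArcCycle hk hka
  exact hσ.hasCycle hcard
end

section
/- Let a ≥ 4 be even and let D be a balanced bipartite digraph with partite sets X = {x_1,...,x_a}, Y = {y_1,...,y_a} and a perfect matching M = {y_i x_i} from Y to X whose contracted digraph D* is isomorphic to the complete bipartite digraph K*_{a/2,a/2} with partite sets {v_1,...,v_{a/2}} and {v_{a/2+1},...,v_a}. If y_{a/2} x_a is an arc of D, then D contains directed cycles of every even length 2k for k = 2, 3, ..., a. -/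
open Finset

/-- A cyclic sequence of `n` distinct vertices with consecutive arcs is a directed cycle. -/
theorem hasCycle_of_seq {V : Type*} {A : V → V → Prop} {n : ℕ} (hn : 2 ≤ n) (g : ℕ → V)
    (hinj : ∀ i < n, ∀ j < n, g i = g j → i = j)
    (hstep : ∀ i, i + 1 < n → A (g i) (g (i + 1))) (hlast : A (g (n - 1)) (g 0)) :
    HasCycle A n := by
  have : NeZero n := ⟨by omega⟩
  have : Fact (1 < n) := ⟨hn⟩
  refine ⟨hn, fun z => g z.val, fun z w h => ?_, fun z => ?_⟩
  · exact ZMod.val_injective n (hinj _ (ZMod.val_lt z) _ (ZMod.val_lt w) h)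
  · have hz := ZMod.val_lt z
    have hval : (z + 1).val = (z.val + 1) % n := by rw [ZMod.val_add, ZMod.val_one]
    by_cases h : z.val + 1 < n
    · simpa only [hval, Nat.mod_eq_of_lt h] using hstep _ h
    · have hz' : z.val = n - 1 := by omega
      have hmod : (n - 1 + 1) % n = 0 := by rw [Nat.sub_add_cancel (by omega), Nat.mod_self]
      simpa only [hval, hz', hmod] using hlast

/-- A cyclic sequence `u 0, w 0, u 1, w 1, …, u (k-1), w (k-1)` of distinct vertices with
consecutive arcs is a directed cycle. -/
theorem hasCycle_of_alternating {V : Type*} {A : V → V → Prop} {k : ℕ} (hk : 1 ≤ k)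
    (u w : ℕ → V) (hu : ∀ i < k, ∀ j < k, u i = u j → i = j)
    (hw : ∀ i < k, ∀ j < k, w i = w j → i = j) (huw : ∀ i j, w i ≠ u j)
    (h₁ : ∀ i < k, A (u i) (w i)) (h₂ : ∀ i, i + 1 < k → A (w i) (u (i + 1)))
    (hlast : A (w (k - 1)) (u 0)) : HasCycle A (2 * k) := by
  refine hasCycle_of_seq (by omega)
    (fun i => if i % 2 = 0 then u (i / 2) else w (i / 2)) ?_ ?_ ?_
  · intro i hi j hj h
    have hi' : i / 2 < k := by omega
    have hj' : j / 2 < k := by omega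
    split_ifs at h
    · have := hu _ hi' _ hj' h
      omega
    · exact (huw _ _ h.symm).elim
    · exact (huw _ _ h).elim
    · have := hw _ hi' _ hj' h
      omega
  · intro i hi
    rcases Nat.even_or_odd' i with ⟨c, rfl | rfl⟩
    · have e₁ : (2 * c + 1) / 2 = c := by omega
      simpa [e₁, Nat.add_mod] using h₁ c (by omega)
    · have e₁ : (2 * c + 1) / 2 = c := by omega
      have e₂ : (2 * c + 1 + 1) / 2 = c + 1 := by omega
      have e₃ : (2 * c + 1 + 1) % 2 = 0 := by omega
      simpa [e₁, e₂, e₃, Nat.add_mod] using h₂ c (by omega)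
  · have e₁ : (2 * k - 1) % 2 = 1 := by omega
    have e₂ : (2 * k - 1) / 2 = k - 1 := by omega
    simpa [e₁, e₂] using hlast

/-- if D* ≅ K*_{a/2,a/2} and y_{a/2} x_a ∈ A(D), then D contains
cycles of every even length 2k, k = 2, …, a. -/
theorem stmt5 {V : Type*} (A : V → V → Prop) (a : ℕ) (ha : 4 ≤ a) (hev : Even a)
    (x y : Fin a → V) (hbip : IndexedBipartite A x y) (hM : ∀ i, A (y i) (x i))
    (hK : ∀ l j : Fin a, Dstar A x y l j ↔ ((l.val < a / 2) ↔ ¬ (j.val < a / 2)))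
    (harc : A (y ⟨a / 2 - 1, by omega⟩) (x ⟨a - 1, by omega⟩)) :
    ∀ k : ℕ, 2 ≤ k → k ≤ a → HasCycle A (2 * k) := by
  intro k hk hka
  obtain ⟨hx, hy, hxy, -, -⟩ := hbip
  have : NeZero a := ⟨by omega⟩
  have hval : ∀ i < a, (Fin.ofNat a i).val = i := fun i hi => Nat.mod_eq_of_lt hi
  have hinj : ∀ i < a, ∀ j < a, Fin.ofNat a i = Fin.ofNat a j → i = j := by
    intro i hi j hj h
    rw [← hval i hi, ← hval j hj, h]
  have hcross : ∀ i < a, ∀ j < a, (i < a / 2 ↔ ¬ j < a / 2) →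
      A (x (Fin.ofNat a i)) (y (Fin.ofNat a j)) := by
    intro i hi j hj h
    refine ((hK _ _).2 ?_).2
    rwa [hval i hi, hval j hj]
  have harc' : A (y (Fin.ofNat a (a / 2 - 1))) (x (Fin.ofNat a (a - 1))) := by
    convert harc using 2
    · exact Fin.ext (hval _ (by omega))
    · exact Fin.ext (hval _ (by omega))
  obtain ⟨m, rfl⟩ := hev
  have hm : (m + m) / 2 = m := by omega
  rw [hm] at harc' hcross
  rcases Nat.even_or_odd' k with ⟨c, rfl | rfl⟩
  · let s : ℕ → ℕ := fun i => if i % 2 = 0 then i / 2 else m + i / 2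
    have hs : ∀ i < 2 * c, s i < m + m := by grind
    have hsinj : ∀ i < 2 * c, ∀ j < 2 * c, s i = s j → i = j := by grind
    refine hasCycle_of_alternating (by omega) (fun i => y (Fin.ofNat _ (s i)))
      (fun i => x (Fin.ofNat _ (s i))) ?_ ?_ (fun _ _ => hxy _ _) (fun _ _ => hM _) ?_ ?_
    · exact fun i hi j hj h => hsinj i hi j hj (hinj _ (hs i hi) _ (hs j hj) (hy h))
    · exact fun i hi j hj h => hsinj i hi j hj (hinj _ (hs i hi) _ (hs j hj) (hx h))
    · exact fun i hi => hcross _ (hs _ (by omega)) _ (hs _ hi) (by grind)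
    · exact hcross _ (hs _ (by omega)) _ (hs _ (by omega)) (by grind)
  · let r : ℕ → ℕ := fun i => if i % 2 = 1 then i / 2 else m + i / 2 - 1
    let s : ℕ → ℕ := fun i => if i = 0 then m - 1 else r i
    let t : ℕ → ℕ := fun i => if i = 0 then m + m - 1 else r i
    have hs : ∀ i < 2 * c + 1, s i < m + m := by grind
    have ht : ∀ i < 2 * c + 1, t i < m + m := by grind
    have hsinj : ∀ i < 2 * c + 1, ∀ j < 2 * c + 1, s i = s j → i = j := by grind
    have htinj : ∀ i < 2 * c + 1, ∀ j < 2 * c + 1, t i = t j → i = j := by grind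
    refine hasCycle_of_alternating (by omega) (fun i => y (Fin.ofNat _ (s i)))
      (fun i => x (Fin.ofNat _ (t i))) ?_ ?_ (fun _ _ => hxy _ _) ?_ ?_ ?_
    · exact fun i hi j hj h => hsinj i hi j hj (hinj _ (hs i hi) _ (hs j hj) (hy h))
    · exact fun i hi j hj h => htinj i hi j hj (hinj _ (ht i hi) _ (ht j hj) (hx h))
    · intro i _
      by_cases h : i = 0
      · simpa [s, t, h] using harc'
      · simpa [s, t, h] using hM _
    · intro i hi
      refine hcross _ (ht _ (by omega)) _ (hs _ hi) ?_
      simp only [s, t, r, Nat.succ_ne_zero, if_false]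
      split_ifs <;> omega
    · refine hcross _ (ht _ (by omega)) _ (hs _ (by omega)) ?_
      simp only [s, t, r]
      split_ifs <;> omega
end

section
/- Let D be a strongly connected balanced bipartite digraph of order 2a ≥ 6 with partite sets X and Y, satisfying d(x)+d(y) ≥ 3a for every pair of distinct vertices from the same partite set. Let M be a perfect matching from Y to X whose size s(M) is maximum among all perfect matchings from Y to X. Then either the contracted digraph D*[M] is strongly connected, or D contains cycles of all even lengths 2, 4, ..., 2a. -/
open Finset

/-- A sequence of vertices closing up after `n` steps gives a cycle of length `n`. -/
theorem hasCycle_of_nat_seq {V : Type*} {A : V → V → Prop} {n : ℕ} (hn : 2 ≤ n) (g : ℕ → V)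
    (hinj : ∀ i < n, ∀ j < n, g i = g j → i = j)
    (harc : ∀ i, i + 1 < n → A (g i) (g (i + 1))) (hlast : A (g (n - 1)) (g 0)) :
    HasCycle A n := by
  obtain ⟨m, rfl⟩ : ∃ m, n = m + 1 := ⟨n - 1, by omega⟩
  refine ⟨hn, fun i => g i.val, fun i j h => ?_, fun i => ?_⟩
  · exact ZMod.val_injective _ (hinj _ (ZMod.val_lt i) _ (ZMod.val_lt j) h)
  · have hi := ZMod.val_lt i
    have : Fact (1 < m + 1) := ⟨by omega⟩
    by_cases h : i.val + 1 < m + 1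
    · have : (i + 1).val = i.val + 1 := by
        rw [ZMod.val_add_of_lt] <;> rw [ZMod.val_one]
        exact h
      simpa only [this] using harc _ h
    · have h1 : i.val = m := by omega
      have h2 : (i + 1).val = 0 := by
        rw [ZMod.val_add, ZMod.val_one, h1, Nat.mod_self]
      simpa only [h1, h2, Nat.add_sub_cancel] using hlast

/-- A cycle of length `2 * k` in the bipartite digraph on two copies of `ι` whose arcs are
given by `P` (first copy to second) and `Q` (second copy to first). -/
def HasAltCycle {ι : Type*} (P Q : ι → ι → Prop) (k : ℕ) : Prop :=
  ∃ p q : ℕ → ι, Set.InjOn p (Set.Iio k) ∧ Set.InjOn q (Set.Iio k) ∧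
    (∀ i < k, P (p i) (q i)) ∧ (∀ i, i + 1 < k → Q (q i) (p (i + 1))) ∧ Q (q (k - 1)) (p 0)

theorem HasAltCycle.reverse {ι : Type*} {P Q : ι → ι → Prop} {k : ℕ}
    (h : HasAltCycle (fun i j => P j i) (fun i j => Q j i) k) : HasAltCycle P Q k := by
  obtain ⟨p, q, hp, hq, hP, hQ, hl⟩ := h
  rcases Nat.eq_zero_or_pos k with rfl | hk
  · exact ⟨q, p, hq, hp, by simp, by simp, hl⟩
  refine ⟨fun i => q (k - 1 - i), fun i => p (k - 1 - i), fun i hi j hj hij => ?_,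
    fun i hi j hj hij => ?_, fun i hi => hP _ (by omega), fun i hi => ?_, by simpa using hl⟩
  · simp only [Set.mem_Iio] at hi hj
    have := hq (Set.mem_Iio.2 (by omega)) (Set.mem_Iio.2 (by omega)) hij
    omega
  · simp only [Set.mem_Iio] at hi hj
    have := hp (Set.mem_Iio.2 (by omega)) (Set.mem_Iio.2 (by omega)) hij
    omega
  · have := hQ (k - 1 - (i + 1)) (by omega)
    rwa [show k - 1 - (i + 1) + 1 = k - 1 - i by omega] at this

theorem HasAltCycle.hasCycle {V ι : Type*} {A : V → V → Prop} {x y : ι → V}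
    (hx : Function.Injective x) (hy : Function.Injective y) (hxy : ∀ i j, x i ≠ y j)
    {k : ℕ} (hk : 1 ≤ k)
    (h : HasAltCycle (fun i j => A (x i) (y j)) (fun i j => A (y i) (x j)) k) :
    HasCycle A (2 * k) := by
  obtain ⟨p, q, hp, hq, hP, hQ, hl⟩ := h
  refine hasCycle_of_nat_seq (by omega)
    (fun n => if n % 2 = 0 then x (p (n / 2)) else y (q (n / 2))) ?_ ?_ ?_
  · intro i hi j hj hij
    rcases Nat.mod_two_eq_zero_or_one i with h1 | h1 <;>
      rcases Nat.mod_two_eq_zero_or_one j with h2 | h2 <;> simp only [h1, h2] at hij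
    · have := hp (Set.mem_Iio.2 (by omega)) (Set.mem_Iio.2 (by omega)) (hx hij)
      omega
    · exact absurd hij (hxy _ _)
    · exact absurd hij.symm (hxy _ _)
    · have := hq (Set.mem_Iio.2 (by omega)) (Set.mem_Iio.2 (by omega)) (hy hij)
      omega
  · intro i hi
    rcases Nat.mod_two_eq_zero_or_one i with h1 | h1
    · have h2 : (i + 1) % 2 = 1 := by omega
      have h3 : (i + 1) / 2 = i / 2 := by omega
      simpa [h1, h2, h3] using hP (i / 2) (by omega)
    · have h2 : (i + 1) % 2 = 0 := by omega
      have h3 : (i + 1) / 2 = i / 2 + 1 := by omega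
      simpa [h1, h2, h3] using hQ (i / 2) (by omega)
  · have h1 : (2 * k - 1) % 2 = 1 := by omega
    have h2 : (2 * k - 1) / 2 = k - 1 := by omega
    simpa [h1, h2] using hl

/-- A finite set can be enumerated starting from any of its elements. -/
theorem Finset.exists_enum_zero_eq {ι : Type*} (S : Finset ι) {c : ι} (hc : c ∈ S) :
    ∃ w : ℕ → ι, Set.InjOn w (Set.Iio S.card) ∧ (∀ i < S.card, w i ∈ S) ∧ w 0 = c := by
  classical
  set L : List ι := c :: (S.erase c).toList with hL
  have hlen : L.length = S.card := by
    have := Finset.card_pos.2 ⟨c, hc⟩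
    simp [hL, Finset.card_erase_of_mem hc]
    omega
  have hnd : L.Nodup := by simp [hL, Finset.nodup_toList]
  have hmem : ∀ z ∈ L, z ∈ S := by
    intro z hz
    rcases List.mem_cons.1 hz with rfl | hz
    · exact hc
    · exact Finset.mem_of_mem_erase (Finset.mem_toList.1 hz)
  refine ⟨fun i => L.getD i c, fun i hi j hj hij => ?_, fun i hi => ?_, by simp [hL]⟩
  · rw [Set.mem_Iio, ← hlen] at hi hj
    simp only [List.getD_eq_getElem _ _ hi, List.getD_eq_getElem _ _ hj] at hij
    exact (hnd.getElem_inj_iff).1 hij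
  · rw [← hlen] at hi
    simp only [List.getD_eq_getElem _ _ hi]
    exact hmem _ (List.getElem_mem hi)

/-- Two complete blocks, joined by all arcs one way and at least one arc the other way,
contain alternating cycles of all lengths. -/
theorem hasAltCycle_of_blocks {ι : Type*} [Fintype ι] [DecidableEq ι] {P Q : ι → ι → Prop}
    {S : Finset ι} (hPS : ∀ i ∈ S, ∀ j ∈ S, P i j) (hQS : ∀ i, ∀ j ∈ S, Q i j)
    (hPT : ∀ i ∉ S, ∀ j ∉ S, P i j) (hQT : ∀ i ∉ S, ∀ j ∉ S, Q i j)
    {i₀ j₀ : ι} (hi₀ : i₀ ∈ S) (hj₀ : j₀ ∉ S) (h₀ : Q i₀ j₀)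
    {k : ℕ} (hk : k ≤ Fintype.card ι) : HasAltCycle P Q k := by
  obtain ⟨u, hu, huS, hu0⟩ := S.exists_enum_zero_eq hi₀
  obtain ⟨v, hv, hvT, hv0⟩ := Sᶜ.exists_enum_zero_eq (Finset.mem_compl.2 hj₀)
  have hcard := Finset.card_add_card_compl S
  have hspos : 0 < S.card := Finset.card_pos.2 ⟨_, hi₀⟩
  set s := S.card
  set w : ℕ → ι := fun i => if i < s then u (s - 1 - i) else v (i - s) with hw
  have hwS : ∀ i < s, w i ∈ S := fun i hi => by
    simp only [hw, if_pos hi]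
    exact huS _ (by omega)
  have hwT : ∀ i, s ≤ i → i < k → w i ∉ S := fun i hi hik => by
    simp only [hw, if_neg (not_lt.2 hi)]
    exact Finset.mem_compl.1 (hvT _ (by omega))
  have hwinj : Set.InjOn w (Set.Iio k) := by
    intro i hi j hj hij
    rw [Set.mem_Iio] at hi hj
    by_cases h1 : i < s <;> by_cases h2 : j < s
    · simp only [hw, if_pos h1, if_pos h2] at hij
      have := hu (Set.mem_Iio.2 (by omega)) (Set.mem_Iio.2 (by omega)) hij
      omega
    · exact absurd (hij ▸ hwS i h1) (hwT j (by omega) hj)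
    · exact absurd (hij ▸ hwS j h2) (hwT i (by omega) hi)
    · simp only [hw, if_neg h1, if_neg h2] at hij
      have := hv (Set.mem_Iio.2 (by omega)) (Set.mem_Iio.2 (by omega)) hij
      omega
  refine ⟨w, w, hwinj, hwinj, fun i hi => ?_, fun i hi => ?_, hQS _ _ (hwS 0 hspos)⟩
  · by_cases h1 : i < s
    · exact hPS _ (hwS i h1) _ (hwS i h1)
    · exact hPT _ (hwT i (by omega) hi) _ (hwT i (by omega) hi)
  · by_cases h1 : i + 1 < s
    · exact hQS _ _ (hwS _ h1)
    · by_cases h2 : i + 1 = s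
      · have e1 : w i = i₀ := by
          rw [← hu0]
          simp only [hw, if_pos (show i < s by omega)]
          congr 1
          omega
        have e2 : w (i + 1) = j₀ := by
          rw [← hv0]
          simp only [hw, if_neg h1]
          congr 1
          omega
        rwa [e1, e2]
      · exact hQT _ (hwT _ (by omega) (by omega)) _ (hwT _ (by omega) hi)

/-- A vertex pair `c` attached to an almost complete block yields alternating cycles of
all lengths. -/
theorem hasAltCycle_of_singleton {ι : Type*} [Fintype ι] [DecidableEq ι] {P Q : ι → ι → Prop}
    {c j₀ : ι} (hcc : P c c) (hQc : ∀ i, Q i c) (hj₀ : j₀ ≠ c) (h₀ : Q c j₀)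
    (hP : ∀ i ≠ c, ∀ j ≠ c, i ≠ j → P i j) (hQ : ∀ i ≠ c, ∀ j ≠ c, Q i j)
    (hcard : 3 ≤ Fintype.card ι) {k : ℕ} (hk : k ≤ Fintype.card ι) : HasAltCycle P Q k := by
  obtain ⟨w, hw, hwT, hw0⟩ :=
    (Finset.univ.erase c).exists_enum_zero_eq (Finset.mem_erase.2 ⟨hj₀, Finset.mem_univ _⟩)
  rw [Finset.card_erase_of_mem (Finset.mem_univ _), Finset.card_univ] at hw hwT
  set a := Fintype.card ι
  have hwc : ∀ i < a - 1, w i ≠ c := fun i hi => Finset.ne_of_mem_erase (hwT i hi)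
  have hinj : ∀ i < a - 1, ∀ j < a - 1, w i = w j → i = j := fun i hi j hj h => hw hi hj h
  set r : ℕ → ℕ := fun i => if i = a - 1 then 0 else i with hr
  have hra : ∀ i < a, r i < a - 1 := fun i hi => by
    simp only [hr]
    split_ifs <;> omega
  refine ⟨fun i => if i = 0 then c else w (i - 1), fun i => if i = 0 then c else w (r i),
    fun i hi j hj hij => ?_, fun i hi j hj hij => ?_, fun i hi => ?_, fun i hi => ?_, ?_⟩
  · rw [Set.mem_Iio] at hi hj
    by_cases h1 : i = 0 <;> by_cases h2 : j = 0 <;> simp only [h1, h2, if_true, if_false] at hij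
    · omega
    · exact absurd hij.symm (hwc _ (by omega))
    · exact absurd hij (hwc _ (by omega))
    · have := hinj _ (by omega) _ (by omega) hij
      omega
  · rw [Set.mem_Iio] at hi hj
    by_cases h1 : i = 0 <;> by_cases h2 : j = 0 <;> simp only [h1, h2, if_true, if_false] at hij
    · omega
    · exact absurd hij.symm (hwc _ (hra _ (by omega)))
    · exact absurd hij (hwc _ (hra _ (by omega)))
    · have := hinj _ (hra _ (by omega)) _ (hra _ (by omega)) hij
      simp only [hr] at this
      split_ifs at this <;> omega
  · by_cases h1 : i = 0
    · simpa only [h1, if_true] using hcc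
    · simp only [h1, if_false]
      refine hP _ (hwc _ (by omega)) _ (hwc _ (hra _ (by omega))) fun h => ?_
      have := hinj _ (by omega) _ (hra _ (by omega)) h
      simp only [hr] at this
      split_ifs at this <;> omega
  · by_cases h1 : i = 0
    · simpa [h1, hw0] using h₀
    · simp only [h1, if_false, Nat.succ_ne_zero, Nat.add_sub_cancel]
      exact hQ _ (hwc _ (hra _ (by omega))) _ (hwc _ (by omega))
  · simpa only [if_true] using hQc _

open Classical in
/-- The degree and exchange conditions force alternating cycles of all lengths when the pair
`c` has no `P`-arc leaving it. -/
theorem hasAltCycle_of_isolated_pair {a : ℕ} (ha : 3 ≤ a) {P Q : Fin a → Fin a → Prop}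
    (hQd : ∀ i, Q i i)
    (hdeg : ∀ i j, i ≠ j → 3 * a ≤
      (#{l | P i l} + #{l | Q l i}) + (#{l | P j l} + #{l | Q l j}))
    (hswap : ∀ i j, i ≠ j → Q i j → Q j i → P i i → P j j → P i j)
    {c j₀ : Fin a} (hc : ∀ j ≠ c, ¬ P c j) (hj₀ : j₀ ≠ c) (h₀ : Q c j₀) (hPc : P c c)
    {k : ℕ} (hk : k ≤ a) : HasAltCycle P Q k := by
  have hmiss : ∀ j ≠ c, #{l | ¬ Q l c} + #{l | ¬ P j l} + #{l | ¬ Q l j} ≤ 1 := by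
    intro j hj
    have h1 := hdeg c j hj.symm
    have h2 : #{l | P c l} ≤ 1 := by
      rw [Finset.card_le_one]
      intro u hu v hv
      simp only [Finset.mem_filter, Finset.mem_univ, true_and] at hu hv
      rw [not_imp_comm.1 (hc u) (not_not.2 hu), not_imp_comm.1 (hc v) (not_not.2 hv)]
    have h3 := Finset.card_filter_add_card_filter_not (s := (univ : Finset (Fin a)))
      (fun l => Q l c)
    have h4 := Finset.card_filter_add_card_filter_not (s := (univ : Finset (Fin a)))
      (fun l => P j l)
    have h5 := Finset.card_filter_add_card_filter_not (s := (univ : Finset (Fin a)))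
      (fun l => Q l j)
    rw [Finset.card_univ, Fintype.card_fin] at h3 h4 h5
    omega
  have hpos : ∀ (R : Fin a → Prop) (l : Fin a), ¬ R l → 1 ≤ #{l | ¬ R l} := fun R l h =>
    Finset.card_pos.2 ⟨l, by simpa using h⟩
  have hQP : ∀ j ≠ c, ∀ l l', ¬ Q l j → P j l' := by
    intro j hj l l' h1
    by_contra h2
    have := hpos (fun l => Q l j) l h1
    have := hpos (fun l => P j l) l' h2
    have := hmiss j hj
    omega
  have hQc : ∀ i, Q i c := by
    intro i
    by_contra h
    have hic : i ≠ c := fun e => h (e ▸ hQd c)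
    have hfull : ∀ j ≠ c, ∀ l, Q l j ∧ P j l ∧ Q l c ∨ Q l j ∧ P j l ∧ l = i := by
      intro j hj l
      have h1 := hmiss j hj
      have h2 := hpos (fun l => Q l c) i h
      have h3 : Q l j := by
        by_contra h3
        have := hpos (fun l => Q l j) l h3
        omega
      have h4 : P j l := by
        by_contra h4
        have := hpos (fun l => P j l) l h4
        omega
      by_cases hl : l = i
      · exact Or.inr ⟨h3, h4, hl⟩
      · refine Or.inl ⟨h3, h4, ?_⟩
        by_contra h5
        have : 1 < #{l | ¬ Q l c} :=
          Finset.one_lt_card.2 ⟨l, by simpa using h5, i, by simpa using h, hl⟩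
        omega
    obtain ⟨j, hj⟩ : ∃ j, j ∉ ({c, i} : Finset (Fin a)) := by
      by_contra! hall
      have h1 := Finset.card_le_card (fun j _ => hall j : (univ : Finset (Fin a)) ⊆ {c, i})
      have h2 := Finset.card_le_two (a := c) (b := i)
      rw [Finset.card_univ, Fintype.card_fin] at h1
      omega
    simp only [Finset.mem_insert, Finset.mem_singleton, not_or] at hj
    have e1 := hfull j hj.1 j
    have e2 := hfull j hj.1 c
    exact hc j hj.1 (hswap c j (Ne.symm hj.1) (by tauto) (by tauto) hPc (by tauto))
  have hPQ : ∀ j ≠ c, Q c j → ¬ P j j := fun j hj h1 h2 =>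
    hc j hj (hswap c j hj.symm h1 (hQc j) hPc h2)
  have hone : ∀ (R : Fin a → Prop) (l l' : Fin a), #{l | ¬ R l} ≤ 1 → ¬ R l → ¬ R l' → l = l' :=
    fun R l l' h h1 h2 => Finset.card_le_one.1 h l (by simpa using h1) l' (by simpa using h2)
  refine hasAltCycle_of_singleton hPc hQc hj₀ h₀ ?_ ?_ (by simpa using ha) (by simpa using hk)
  · intro i hi j hj hij
    by_contra h
    have h1 : Q c i := not_not.1 fun h1 => h (hQP i hi c j h1)
    refine hij (hone (fun l => P i l) i j ?_ (hPQ i hi h1) h)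
    have := hmiss i hi
    omega
  · intro i hi j hj
    by_contra h
    have h1 : Q c j := by
      by_contra h1
      refine hi (hone (fun l => Q l j) i c ?_ h h1)
      have := hmiss j hj
      omega
    exact hPQ j hj h1 (hQP j hj i j h)

open Classical in
/-- In a digraph on two copies of `Fin a` satisfying the degree condition and the exchange
condition, a set `S` that no `P`-arc leaves forces alternating cycles of all lengths. -/
theorem hasAltCycle_of_closed {a : ℕ} (ha : 3 ≤ a) {P Q : Fin a → Fin a → Prop}
    (hQd : ∀ i, Q i i)
    (hdegx : ∀ i j, i ≠ j → 3 * a ≤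
      (#{l | P i l} + #{l | Q l i}) + (#{l | P j l} + #{l | Q l j}))
    (hdegy : ∀ i j, i ≠ j → 3 * a ≤
      (#{l | P l i} + #{l | Q i l}) + (#{l | P l j} + #{l | Q j l}))
    (hswap : ∀ i j, i ≠ j → Q i j → Q j i → P i i → P j j → P i j)
    (hPout : ∀ i, ∃ j, P i j) (hPin : ∀ j, ∃ i, P i j)
    {S : Finset (Fin a)} (hS : ∀ i ∈ S, ∀ j ∉ S, ¬ P i j)
    {i₀ j₀ : Fin a} (hi₀ : i₀ ∈ S) (hj₀ : j₀ ∉ S) (h₀ : Q i₀ j₀)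
    {k : ℕ} (hk : k ≤ a) : HasAltCycle P Q k := by
  have hcard := Finset.card_add_card_compl S
  rw [Fintype.card_fin] at hcard
  have hle : ∀ R : Fin a → Prop, #{l | R l} ≤ a := fun R =>
    (Finset.card_le_univ _).trans_eq (Fintype.card_fin a)
  have hPS : ∀ i ∈ S, ({l | P i l} : Finset (Fin a)) ⊆ S := fun i hi l hl => by
    by_contra h
    exact hS i hi l h (by simpa using hl)
  have hPT : ∀ j ∈ Sᶜ, ({l | P l j} : Finset (Fin a)) ⊆ Sᶜ := fun j hj l hl => by
    rw [Finset.mem_compl] at hj ⊢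
    exact fun h => hS l h j hj (by simpa using hl)
  have hj₀' : j₀ ∈ Sᶜ := Finset.mem_compl.2 hj₀
  rcases (Finset.one_le_card.2 ⟨i₀, hi₀⟩).eq_or_lt with h1 | h1
  · obtain ⟨c, rfl⟩ := Finset.card_eq_one.1 h1.symm
    obtain rfl := Finset.mem_singleton.1 hi₀
    have hc : ∀ j ≠ i₀, ¬ P i₀ j := fun j hj => hS i₀ hi₀ j (by simpa using hj)
    obtain ⟨l, hl⟩ := hPout i₀
    have hli : l = i₀ := by
      by_contra h
      exact hc l h hl
    exact hasAltCycle_of_isolated_pair ha hQd hdegx hswap hc (by simpa using hj₀) h₀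
      (hli ▸ hl) hk
  rcases (Finset.one_le_card.2 ⟨j₀, hj₀'⟩).eq_or_lt with h2 | h2
  · obtain ⟨c, hc⟩ := Finset.card_eq_one.1 h2.symm
    have hmem : ∀ i, i ∈ S ↔ i ≠ c := fun i => by
      rw [← not_iff_not, ← Finset.mem_compl, hc, Finset.mem_singleton, not_not]
    obtain rfl : j₀ = c := by simpa [hc] using hj₀'
    have hc : ∀ j ≠ j₀, ¬ P j j₀ := fun j hj => hS j ((hmem j).2 hj) j₀ hj₀
    obtain ⟨l, hl⟩ := hPin j₀
    have hli : l = j₀ := by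
      by_contra h
      exact hc l h hl
    refine HasAltCycle.reverse (hasAltCycle_of_isolated_pair
      (P := fun i j => P j i) (Q := fun i j => Q j i) ha hQd hdegy
      (fun i j hij q1 q2 p1 p2 => hswap j i hij.symm q1 q2 p2 p1) hc
      ((hmem i₀).1 hi₀) h₀ (hli ▸ hl) hk)
  have hbound : ∀ i ∈ S, #{l | P i l} ≤ #S := fun i hi => Finset.card_le_card (hPS i hi)
  have hbound' : ∀ j ∈ Sᶜ, #{l | P l j} ≤ #Sᶜ := fun j hj => Finset.card_le_card (hPT j hj)
  have hs : a ≤ 2 * #S := by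
    obtain ⟨i, hi, j, hj, hij⟩ := Finset.one_lt_card.1 h1
    have := hdegx i j hij
    have := hbound i hi
    have := hbound j hj
    have := hle fun l => Q l i
    have := hle fun l => Q l j
    omega
  have ht : a ≤ 2 * #Sᶜ := by
    obtain ⟨i, hi, j, hj, hij⟩ := Finset.one_lt_card.1 h2
    have := hdegy i j hij
    have := hbound' i hi
    have := hbound' j hj
    have := hle fun l => Q i l
    have := hle fun l => Q j l
    omega
  have hfull : ∀ R : Fin a → Prop, a ≤ #{l | R l} → ∀ l, R l := fun R h l => by
    have : ({l | R l} : Finset (Fin a)) = univ :=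
      Finset.eq_univ_of_card _ (by
        rw [Fintype.card_fin]
        exact le_antisymm (hle R) h)
    exact (Finset.mem_filter.1 (this.ge (Finset.mem_univ l))).2
  have hSfull : ∀ i ∈ S, (∀ j ∈ S, P i j) ∧ ∀ l, Q l i := by
    intro i hi
    obtain ⟨j, hj, hij⟩ := Finset.exists_mem_ne h1 i
    have := hdegx i j hij.symm
    have := hbound i hi
    have := hbound j hj
    have := hle fun l => Q l i
    have := hle fun l => Q l j
    refine ⟨fun l hl => ?_, hfull _ (by omega)⟩
    rw [← Finset.eq_of_subset_of_card_le (hPS i hi) (by omega)] at hl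
    simpa using hl
  have hTfull : ∀ i ∈ Sᶜ, (∀ j ∈ Sᶜ, P j i) ∧ ∀ l, Q i l := by
    intro i hi
    obtain ⟨j, hj, hij⟩ := Finset.exists_mem_ne h2 i
    have := hdegy i j hij.symm
    have := hbound' i hi
    have := hbound' j hj
    have := hle fun l => Q i l
    have := hle fun l => Q j l
    refine ⟨fun l hl => ?_, hfull _ (by omega)⟩
    rw [← Finset.eq_of_subset_of_card_le (hPT i hi) (by omega)] at hl
    simpa using hl
  exact hasAltCycle_of_blocks (fun i hi => (hSfull i hi).1) (fun i j hj => (hSfull j hj).2 i)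
    (fun i hi j hj => (hTfull j (Finset.mem_compl.2 hj)).1 i (Finset.mem_compl.2 hi))
    (fun i hi j _ => (hTfull i (Finset.mem_compl.2 hi)).2 j) hi₀ hj₀ h₀ (by simpa using hk)

/-- If all elements satisfying `R` lie in the range of the injection `f`, they can be counted
through `f`. -/
theorem card_filter_comp_of_injective {ι V : Type*} [Fintype ι] [Fintype V] {f : ι → V}
    (hf : Function.Injective f) (R : V → Prop) [DecidablePred R]
    [DecidablePred fun i => R (f i)] (h : ∀ v, R v → ∃ i, v = f i) :
    #{v | R v} = #{i | R (f i)} := by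
  rw [← Finset.card_map ⟨f, hf⟩]
  congr 1
  ext v
  simp only [Finset.mem_filter, Finset.mem_univ, true_and, Finset.mem_map,
    Function.Embedding.coeFn_mk]
  constructor
  · intro hv
    obtain ⟨i, rfl⟩ := h v hv
    exact ⟨i, hv, rfl⟩
  · rintro ⟨i, hi, rfl⟩
    exact hi

/-- In a maximum-size matching, two pairs with arcs in both directions that can be exchanged
keep both arcs after the exchange. -/
theorem IsMaxMatching.arc_of_exchange {V : Type*} {A : V → V → Prop} [DecidableRel A] {a : ℕ}
    {x y : Fin a → V} (hmax : IsMaxMatching A x y) {i j : Fin a}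
    (hQ : A (y i) (x j)) (hQ' : A (y j) (x i)) (hi : A (x i) (y i)) (hj : A (x j) (y j)) :
    A (x i) (y j) := by
  by_contra h
  have hle := hmax.2 (Equiv.swap i j) fun l => by
    by_cases h1 : l = i
    · rwa [h1, Equiv.swap_apply_left]
    by_cases h2 : l = j
    · rwa [h2, Equiv.swap_apply_right]
    rw [Equiv.swap_apply_of_ne_of_ne h1 h2]
    exact hmax.1 l
  refine absurd hle (not_le.2 (Finset.card_lt_card ?_))
  rw [Finset.ssubset_iff_of_subset]
  · exact ⟨j, Finset.mem_filter.2 ⟨Finset.mem_univ _, by simpa using h⟩,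
      fun hmem => (Finset.mem_filter.1 hmem).2 hj⟩
  · intro l hl
    replace hl : ¬ A (x l) (y l) := (Finset.mem_filter.1 hl).2
    refine Finset.mem_filter.2 ⟨Finset.mem_univ _, ?_⟩
    have h1 : l ≠ i := fun e => hl (e ▸ hi)
    have h2 : l ≠ j := fun e => hl (e ▸ hj)
    rwa [Equiv.swap_apply_of_ne_of_ne h1 h2]

/-- In a strongly connected digraph an arc leaves every proper nonempty set. -/
theorem StrongConn.exists_arc_leaving {V : Type*} {A : V → V → Prop} (h : StrongConn A)
    {W : V → Prop} {u v : V} (hu : W u) (hv : ¬ W v) : ∃ s t, W s ∧ ¬ W t ∧ A s t := by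
  by_contra! hno
  refine hv ?_
  induction h u v with
  | refl => exact hu
  | tail _ hbc ih =>
    by_contra hc
    exact hno _ _ (not_not.1 fun hb => hb (ih hb)) hc hbc

/-- for a maximum-size matching M, either D*[M] is strongly
connected or D is even pancyclic. -/
theorem stmt6 {V : Type*} [Fintype V] (A : V → V → Prop) [DecidableRel A]
    (a : ℕ) (ha : 3 ≤ a) (x y : Fin a → V) (hbip : IndexedBipartite A x y)
    (hstrong : StrongConn A)
    (hdegx : ∀ i j : Fin a, i ≠ j → 3 * a ≤ deg A (x i) + deg A (x j))
    (hdegy : ∀ i j : Fin a, i ≠ j → 3 * a ≤ deg A (y i) + deg A (y j))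
    (hmax : IsMaxMatching A x y) :
    StrongConn (Dstar A x y) ∨ ∀ k : ℕ, 1 ≤ k → k ≤ a → HasCycle A (2 * k) := by
  obtain ⟨hx, hy, hxy, hcov, harc⟩ := hbip
  have hxo : ∀ i v, A (x i) v → ∃ j, v = y j := fun i v h => by
    rcases harc _ _ h with ⟨_, j, _, e⟩ | ⟨l, _, e, _⟩
    · exact ⟨j, e⟩
    · exact absurd e (hxy _ _)
  have hxi : ∀ i v, A v (x i) → ∃ j, v = y j := fun i v h => by
    rcases harc _ _ h with ⟨_, j, _, e⟩ | ⟨l, _, e, _⟩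
    · exact absurd e (hxy _ _)
    · exact ⟨l, e⟩
  have hyo : ∀ i v, A (y i) v → ∃ j, v = x j := fun i v h => by
    rcases harc _ _ h with ⟨l, _, e, _⟩ | ⟨_, j, _, e⟩
    · exact absurd e.symm (hxy _ _)
    · exact ⟨j, e⟩
  have hyi : ∀ i v, A v (y i) → ∃ j, v = x j := fun i v h => by
    rcases harc _ _ h with ⟨l, _, e, _⟩ | ⟨_, j, _, e⟩
    · exact ⟨l, e⟩
    · exact absurd e.symm (hxy _ _)
  rw [or_iff_not_imp_left]
  intro hns k hk hka
  classical
  simp only [StrongConn, not_forall] at hns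
  obtain ⟨u, v, huv⟩ := hns
  set S : Finset (Fin a) := {w | Relation.ReflTransGen (Dstar A x y) u w} with hSdef
  have hmemS : ∀ w, w ∈ S ↔ Relation.ReflTransGen (Dstar A x y) u w := fun w => by simp [hSdef]
  have huS : u ∈ S := (hmemS u).2 .refl
  have hvS : v ∉ S := fun h => huv ((hmemS v).1 h)
  have hS : ∀ i ∈ S, ∀ j ∉ S, ¬ A (x i) (y j) := fun i hi j hj h =>
    hj ((hmemS j).2 (((hmemS i).1 hi).tail ⟨fun e => hj (e ▸ hi), h⟩))
  obtain ⟨i₀, hi₀, j₀, hj₀, h₀⟩ : ∃ i ∈ S, ∃ j ∉ S, A (y i) (x j) := by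
    obtain ⟨s, t, ⟨i, hi, hs⟩, ht, hst⟩ := hstrong.exists_arc_leaving
      (W := fun w => ∃ i ∈ S, w = x i ∨ w = y i) ⟨u, huS, Or.inl rfl⟩
      (show ¬ ∃ i ∈ S, x v = x i ∨ x v = y i by
        rintro ⟨i, hi, e | e⟩
        · exact hvS (hx e ▸ hi)
        · exact hxy _ _ e)
    rcases hs with rfl | rfl
    · obtain ⟨j, rfl⟩ := hxo _ _ hst
      exact absurd hst (hS i hi j fun hj => ht ⟨j, hj, Or.inr rfl⟩)
    · obtain ⟨j, rfl⟩ := hyo _ _ hst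
      exact ⟨i, hi, j, fun hj => ht ⟨j, hj, Or.inl rfl⟩, hst⟩
  have hPout : ∀ i, ∃ j, A (x i) (y j) := fun i => by
    obtain ⟨s, t, rfl, -, h⟩ := hstrong.exists_arc_leaving (W := (· = x i)) rfl (hxy i i).symm
    obtain ⟨j, rfl⟩ := hxo _ _ h
    exact ⟨j, h⟩
  have hPin : ∀ j, ∃ i, A (x i) (y j) := fun j => by
    obtain ⟨s, t, -, ht, h⟩ :=
      hstrong.exists_arc_leaving (W := (· ≠ y j)) (hxy j j) (not_not.2 rfl)
    obtain rfl := not_not.1 ht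
    obtain ⟨i, rfl⟩ := hyi _ _ h
    exact ⟨i, h⟩
  have hdx : ∀ i, deg A (x i) = #{l | A (x i) (y l)} + #{l | A (y l) (x i)} := fun i =>
    congrArg₂ (· + ·) (card_filter_comp_of_injective hy (fun v => A (x i) v) (hxo i))
      (card_filter_comp_of_injective hy (fun v => A v (x i)) (hxi i))
  have hdy : ∀ i, deg A (y i) = #{l | A (x l) (y i)} + #{l | A (y i) (x l)} := fun i =>
    (Nat.add_comm _ _).trans
      (congrArg₂ (· + ·) (card_filter_comp_of_injective hx (fun v => A v (y i)) (hyi i))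
        (card_filter_comp_of_injective hx (fun v => A (y i) v) (hyo i)))
  refine HasAltCycle.hasCycle hx hy hxy hk
    (hasAltCycle_of_closed (P := fun i j => A (x i) (y j)) (Q := fun i j => A (y i) (x j))
      ha hmax.1 ?_ ?_
      (fun i j _ q1 q2 p1 p2 => hmax.arc_of_exchange q1 q2 p1 p2) hPout hPin hS hi₀ hj₀ h₀ hka)
  · intro i j hij
    have := hdegx i j hij
    rw [hdx, hdx] at this
    convert this
  · intro i j hij
    have := hdegy i j hij
    rw [hdy, hdy] at this
    convert this
end

section
/- Let D be a strongly connected balanced bipartite digraph of order 2a ≥ 4 with partite sets X and Y. If d(x)+d(y) ≥ 3a for every pair of vertices x, y that have a common in-neighbor or a common out-neighbor, then D contains a perfect matching from Y to X and a perfect matching from X to Y. -/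
open Finset

theorem BipartiteWith.symm {V : Type*} [Fintype V] [DecidableEq V] {A : V → V → Prop}
    {X Y : Finset V} (h : BipartiteWith A X Y) : BipartiteWith A Y X :=
  ⟨h.1.symm, by rw [Finset.union_comm]; exact h.2.1, fun u v huv => (h.2.2 u v huv).symm⟩

theorem BipartiteWith.mem_left_of_adj {V : Type*} [Fintype V] [DecidableEq V] {A : V → V → Prop}
    {X Y : Finset V} (h : BipartiteWith A X Y) {u v : V} (hv : v ∈ Y) (huv : A u v) : u ∈ X := by
  rcases h.2.2 u v huv with h' | h'
  · exact h'.1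
  · exact absurd hv (Finset.disjoint_left.mp h.1 h'.2)

theorem BipartiteWith.mem_right_of_adj {V : Type*} [Fintype V] [DecidableEq V] {A : V → V → Prop}
    {X Y : Finset V} (h : BipartiteWith A X Y) {u v : V} (hu : u ∈ X) (huv : A u v) : v ∈ Y := by
  rcases h.2.2 u v huv with h' | h'
  · exact h'.2
  · exact absurd h'.1 (Finset.disjoint_left.mp h.1 hu)

theorem StrongConn.exists_out {V : Type*} [Nontrivial V] {A : V → V → Prop} (h : StrongConn A)
    (u : V) : ∃ v, A u v := by
  obtain ⟨w, hw⟩ := exists_ne u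
  rcases (h u w).cases_head with h' | ⟨c, hc, -⟩
  · exact absurd h'.symm hw
  · exact ⟨c, hc⟩

theorem StrongConn.exists_in {V : Type*} [Nontrivial V] {A : V → V → Prop} (h : StrongConn A)
    (u : V) : ∃ v, A v u := by
  obtain ⟨w, hw⟩ := exists_ne u
  rcases (h w u).cases_tail with h' | ⟨c, -, hc⟩
  · exact absurd h'.symm hw
  · exact ⟨c, hc⟩

theorem outDeg_le_card {V : Type*} [Fintype V] {A : V → V → Prop} [DecidableRel A] {u : V}
    {S : Finset V} (h : ∀ v, A u v → v ∈ S) : outDeg A u ≤ S.card :=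
  Finset.card_le_card fun v hv => h v (Finset.mem_filter.mp hv).2

theorem inDeg_le_card {V : Type*} [Fintype V] {A : V → V → Prop} [DecidableRel A] {u : V}
    {S : Finset V} (h : ∀ v, A v u → v ∈ S) : inDeg A u ≤ S.card :=
  Finset.card_le_card fun v hv => h v (Finset.mem_filter.mp hv).2

/-- Hall's condition for the arcs from `Y` to `X`: if `N` contains all out-neighbours of `S ⊆ Y`
then `N` is at least as large as `S`. -/
theorem card_le_card_of_forall_out_mem {V : Type*} [Fintype V] [DecidableEq V] [Nontrivial V]
    {A : V → V → Prop} [DecidableRel A] {a : ℕ} {X Y : Finset V}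
    (hX : X.card = a) (hY : Y.card = a)
    (hbip : BipartiteWith A X Y) (hstrong : StrongConn A)
    (hdeg : ∀ u v : V, u ≠ v → ((∃ z, A z u ∧ A z v) ∨ (∃ z, A u z ∧ A v z)) →
      3 * a ≤ deg A u + deg A v)
    {S N : Finset V} (hSY : S ⊆ Y) (hNX : N ⊆ X) (hSN : ∀ u ∈ S, ∀ v, A u v → v ∈ N) :
    S.card ≤ N.card := by
  by_contra! hlt
  choose o ho using hstrong.exists_out
  choose p hp using hstrong.exists_in
  obtain ⟨y₁, hy₁, y₂, hy₂, hne, heq⟩ := Finset.exists_ne_map_eq_of_card_lt_of_maps_to hlt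
    (f := o) (fun u hu => hSN u hu _ (ho u))
  have hy := hdeg y₁ y₂ hne (Or.inr ⟨o y₁, ho y₁, heq ▸ ho y₂⟩)
  have hT : ∀ v ∈ X \ N, ∀ u, A u v → u ∈ Y \ S := fun v hv u huv => by
    rw [Finset.mem_sdiff] at hv ⊢
    exact ⟨hbip.symm.mem_left_of_adj hv.1 huv, fun hu => hv.2 (hSN u hu v huv)⟩
  have hcX := Finset.card_sdiff_add_card_eq_card hNX
  have hcY := Finset.card_sdiff_add_card_eq_card hSY
  obtain ⟨x₁, hx₁, x₂, hx₂, hne', heq'⟩ := Finset.exists_ne_map_eq_of_card_lt_of_maps_to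
    (show (Y \ S).card < (X \ N).card by omega) (f := p) (fun v hv => hT v hv _ (hp v))
  have hx := hdeg x₁ x₂ hne' (Or.inl ⟨p x₁, hp x₁, heq' ▸ hp x₂⟩)
  have hdy : ∀ y ∈ S, deg A y ≤ N.card + X.card := fun y hy =>
    add_le_add (outDeg_le_card (hSN y hy))
      (inDeg_le_card fun _ h => hbip.mem_left_of_adj (hSY hy) h)
  have hdx : ∀ x ∈ X \ N, deg A x ≤ Y.card + (Y \ S).card := fun x hx =>
    add_le_add (outDeg_le_card fun _ h => hbip.mem_right_of_adj (Finset.mem_sdiff.mp hx).1 h)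
      (inDeg_le_card (hT x hx))
  have := hdy y₁ hy₁
  have := hdy y₂ hy₂
  have := hdx x₁ hx₁
  have := hdx x₂ hx₂
  omega

theorem exists_perfect_matching {V : Type*} [Fintype V] [DecidableEq V] [Nontrivial V]
    {A : V → V → Prop} [DecidableRel A] {a : ℕ} {X Y : Finset V}
    (hX : X.card = a) (hY : Y.card = a)
    (hbip : BipartiteWith A X Y) (hstrong : StrongConn A)
    (hdeg : ∀ u v : V, u ≠ v → ((∃ z, A z u ∧ A z v) ∨ (∃ z, A u z ∧ A v z)) →
      3 * a ≤ deg A u + deg A v) :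
    ∃ f : V → V, Set.InjOn f ↑Y ∧ ∀ v ∈ Y, f v ∈ X ∧ A v (f v) := by
  obtain ⟨g, hg, hgA⟩ := (Finset.all_card_le_biUnion_card_iff_exists_injective
    (fun y : Y => Finset.univ.filter fun v => A y v)).mp (fun s => by
      rw [← Finset.card_map (Function.Embedding.subtype (· ∈ Y))]
      refine card_le_card_of_forall_out_mem hX hY hbip hstrong hdeg ?_ ?_ ?_
      · intro u hu
        obtain ⟨y, -, rfl⟩ := Finset.mem_map.mp hu
        exact y.2
      · intro v hv
        obtain ⟨y, -, hyv⟩ := Finset.mem_biUnion.mp hv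
        exact hbip.symm.mem_right_of_adj y.2 (Finset.mem_filter.mp hyv).2
      · intro u hu v huv
        obtain ⟨y, hy, rfl⟩ := Finset.mem_map.mp hu
        exact Finset.mem_biUnion.mpr ⟨y, hy, Finset.mem_filter.mpr ⟨Finset.mem_univ v, huv⟩⟩)
  have hA : ∀ y : Y, A y (g y) := fun y => (Finset.mem_filter.mp (hgA y)).2
  refine ⟨fun v => if h : v ∈ Y then g ⟨v, h⟩ else v, fun u hu v hv huv => ?_, fun v hv => ?_⟩
  · rw [Finset.mem_coe] at hu hv
    simp only [hu, hv, dif_pos] at huv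
    exact congrArg Subtype.val (hg huv)
  · simp only [hv, dif_pos]
    exact ⟨hbip.symm.mem_right_of_adj hv (hA ⟨v, hv⟩), hA ⟨v, hv⟩⟩

/-- Adamus' matching lemma: existence of perfect matchings from
Y to X and from X to Y. -/
theorem stmt10 {V : Type*} [Fintype V] [DecidableEq V] (A : V → V → Prop) [DecidableRel A]
    (a : ℕ) (ha : 2 ≤ a) (X Y : Finset V)
    (hcard : Fintype.card V = 2 * a) (hX : X.card = a) (hY : Y.card = a)
    (hbip : BipartiteWith A X Y) (hstrong : StrongConn A)
    (hdeg : ∀ u v : V, u ≠ v → ((∃ z, A z u ∧ A z v) ∨ (∃ z, A u z ∧ A v z)) →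
      3 * a ≤ deg A u + deg A v) :
    (∃ f : V → V, Set.InjOn f ↑Y ∧ ∀ v ∈ Y, f v ∈ X ∧ A v (f v)) ∧
    (∃ g : V → V, Set.InjOn g ↑X ∧ ∀ v ∈ X, g v ∈ Y ∧ A v (g v)) := by
  have : Nontrivial V := Fintype.one_lt_card_iff_nontrivial.mp (by omega)
  exact ⟨exists_perfect_matching hX hY hbip hstrong hdeg,
    exists_perfect_matching hY hX hbip.symm hstrong hdeg⟩
end
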